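/- Let Ω ⊂ ℝ² be a bounded, open, simply connected set, ψ : ∂Ω → ℝ continuous, with (Ω, ψ) satisfying the bounded slope condition. Assume α(ρ) := ρ f''(ρ)/f'(ρ) has a finite limit as ρ → 0⁺ and a strictly positive limit α∞ as ρ → +∞. Let (fₐ) be a sequence converging uniformly to f on [0,∞), each fₐ strictly convex, continuously differentiable on [0,∞), twice continuously differentiable on (0,∞), with f'ₐ(0) = 0, f'ₐ a strictly increasing bijection of [0,∞) onto [0,∞) with inverse g'ₐ, and with αₐ(ρ) := ρ f''ₐ(ρ)/f'ₐ(ρ) having a positive limit as ρ → 0⁺ (defining αₐ(0) as this limit). Let uₐ be Lipschitz minimizers of Jₐ(w) = ∫_Ω fₐ(‖∇w‖) dx with boundary values ψ, and vₐ the unique zero-mean Lipschitz stream functions of uₐ (∫_Ω vₐ = 0 and a.e. ∂ₓvₐ = −f'ₐ(‖∇uₐ‖)∂ᵧuₐ/‖∇uₐ‖, ∂ᵧvₐ = f'ₐ(‖∇uₐ‖)∂ₓuₐ/‖∇uₐ‖, right-hand sides taken as 0 where ∇uₐ = 0). Assume the functions r ↦ αₐ(g'ₐ(r)) converge uniformly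 on every compact subset of [0,∞) to a function β. Then (vₐ) contains a subsequence converging uniformly on Ω to a function v which is a viscosity solution in Ω of −[1 − β(‖∇v‖)]·Δ∞v − ‖∇v‖²·β(‖∇v‖)·Δv = 0. -/

import Mathlib

open Set MeasureTheory Metric Filter
open scoped RealInnerProductSpace Topology Classical

noncomputable section

abbrev E2 := EuclideanSpace ℝ (Fin 2)

/-- A function is Lipschitz on a set (with some constant). -/
def LipOn (w : E2 → ℝ) (s : Set E2) : Prop := ∃ L : NNReal, LipschitzOnWith L w s

/-- The functional `J(w) = ∫_Ω f(‖∇w‖)`, with `∇w` the a.e.-defined (Rademacher) gradient,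
extended by the junk value `0` where `w` is not differentiable. -/
def J (f : ℝ → ℝ) (Ω : Set E2) (w : E2 → ℝ) : ℝ := ∫ x in Ω, f ‖gradient w x‖

/-- The (one-sided at `0`) derivative of `f` on `[0,∞)`. -/
def dtop (f : ℝ → ℝ) : ℝ → ℝ := derivWithin f (Set.Ici 0)

/-- Standing assumptions on the Lagrangian `f` : strictly convex on `[0,∞)`, `C¹` on `[0,∞)`,
`C²` on `(0,∞)` with `f''` locally Hölder continuous of some exponent `λ ∈ (0,1)`,
and `f'(0) > 0`. -/
def StdF (f : ℝ → ℝ) : Prop :=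
  StrictConvexOn ℝ (Set.Ici 0) f ∧ ContDiffOn ℝ 1 f (Set.Ici 0) ∧
  ContDiffOn ℝ 2 f (Set.Ioi 0) ∧
  (∃ lam : NNReal, 0 < lam ∧ lam < 1 ∧ ∀ K : Set ℝ, IsCompact K → K ⊆ Set.Ioi 0 →
    ∃ C : NNReal, HolderOnWith C lam (deriv (dtop f)) K) ∧
  0 < dtop f 0

/-- `u` solves the variational problem (P): `u` is Lipschitz on the closure of `Ω`,
`u = ψ` on `∂Ω`, and `u` minimizes `J` among such functions. -/
def SolvesP (f : ℝ → ℝ) (Ω : Set E2) (ψ : E2 → ℝ) (u : E2 → ℝ) : Prop :=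
  LipOn u (closure Ω) ∧ EqOn u ψ (frontier Ω) ∧
  ∀ w : E2 → ℝ, LipOn w (closure Ω) → EqOn w ψ (frontier Ω) → J f Ω u ≤ J f Ω w

/-- `u` has an isolated critical point in `Ω`. -/
def HasIsolatedCritPt (Ω : Set E2) (u : E2 → ℝ) : Prop :=
  ∃ z₀ ∈ Ω, ∃ r > (0:ℝ), gradient u z₀ = 0 ∧
    ∀ z ∈ Ω, z ≠ z₀ → dist z z₀ < r → gradient u z ≠ 0

/-- `v` is a zero-mean stream function for `u` on `Ω` (relative to the Lagrangian derivative
`f'`): `v` is Lipschitz on `Ω`, has zero mean on `Ω`, and satisfies almost everywhere in `Ω`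
`∂ₓv = −f'(‖∇u‖)∂ᵧu/‖∇u‖`, `∂ᵧv = f'(‖∇u‖)∂ₓu/‖∇u‖` (right-hand sides taken to be `0`
where `∇u = 0`). -/
def IsStreamFn (f' : ℝ → ℝ) (Ω : Set E2) (u v : E2 → ℝ) : Prop :=
  LipOn v Ω ∧ (∫ z in Ω, v z) = 0 ∧
  ∀ᵐ z ∂(volume.restrict Ω),
    gradient v z 0 = (if gradient u z = 0 then 0
      else -(f' ‖gradient u z‖ * gradient u z 1 / ‖gradient u z‖)) ∧
    gradient v z 1 = (if gradient u z = 0 then 0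
      else f' ‖gradient u z‖ * gradient u z 0 / ‖gradient u z‖)

/-- `(Ω, ψ)` satisfies the bounded slope condition with constant `Q`. -/
def BSC (Ω : Set E2) (ψ : E2 → ℝ) (Q : ℝ) : Prop :=
  ∀ x₀ ∈ frontier Ω, ∃ a b : E2, ∃ c d : ℝ,
    ‖a‖ ≤ Q ∧ ‖b‖ ≤ Q ∧
    (∀ x ∈ frontier Ω, ⟪a, x⟫ + c ≤ ψ x ∧ ψ x ≤ ⟪b, x⟫ + d) ∧
    ⟪a, x₀⟫ + c = ψ x₀ ∧ ⟪b, x₀⟫ + d = ψ x₀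

/-- The Fenchel conjugate of `f`: `g(r) = sup {ρr − f(ρ) : ρ ≥ 0}`. -/
def fenchel (f : ℝ → ℝ) (r : ℝ) : ℝ := sSup ((fun ρ => ρ * r - f ρ) '' Set.Ici 0)

/-- `w` is a viscosity solution of `F(∇w, ∇²w) = 0` in `Ω ⊆ ℝ²`. -/
def ViscositySol (Ω : Set E2) (F : E2 → (E2 →L[ℝ] E2) → ℝ) (w : E2 → ℝ) : Prop :=
  ContinuousOn w Ω ∧
  (∀ x ∈ Ω, ∀ φ : E2 → ℝ, ContDiff ℝ 2 φ →
    IsLocalMaxOn (fun y => w y - φ y) Ω x →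
    F (gradient φ x) (fderiv ℝ (gradient φ) x) ≤ 0) ∧
  (∀ x ∈ Ω, ∀ φ : E2 → ℝ, ContDiff ℝ 2 φ →
    IsLocalMinOn (fun y => w y - φ y) Ω x →
    0 ≤ F (gradient φ x) (fderiv ℝ (gradient φ) x))

lemma gradient_eq_zero_of_nonneg {η : E2 → ℝ} (h : ∀ x, 0 ≤ η x) {x : E2} (hx : η x = 0) :
    gradient η x = 0 := by
  have : IsLocalMin η x := Eventually.of_forall fun y => by rw [hx]; exact h y
  simp [gradient, this.fderiv_eq_zero]

lemma gradient_congr_of_isOpen {f g : E2 → ℝ} {U : Set E2} (hU : IsOpen U) (h : EqOn f g U)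
    {x : E2} (hx : x ∈ U) : gradient f x = gradient g x :=
  (h.eventuallyEq_of_mem (hU.mem_nhds hx)).gradient_eq

lemma norm_gradient_le {w : E2 → ℝ} {K : NNReal} {U : Set E2} (hw : LipschitzOnWith K w U)
    {x : E2} (hx : U ∈ 𝓝 x) : ‖gradient w x‖ ≤ K := by
  simpa [gradient] using norm_fderiv_le_of_lipschitzOn ℝ hx hw

lemma measurable_gradient (w : E2 → ℝ) : Measurable (gradient w) := by
  unfold gradient
  exact ((InnerProductSpace.toDual ℝ E2).symm.continuous.measurable).comp (measurable_fderiv ℝ w)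

lemma gradient_neg_fun (w : E2 → ℝ) (x : E2) : gradient (fun y => -w y) x = -gradient w x := by
  simp [gradient, fderiv_fun_neg]

lemma gradient_apply_eq_lineDeriv {w : E2 → ℝ} {x : E2} (h : DifferentiableAt ℝ w x) (i : Fin 2) :
    gradient w x i = lineDeriv ℝ w x (EuclideanSpace.single i 1) := by
  rw [h.lineDeriv_eq_fderiv]
  have := inner_gradient_left (𝕜 := ℝ) (f := w) (x := x) (y := EuclideanSpace.single i (1 : ℝ))
  rw [← this, EuclideanSpace.inner_single_right]
  simp

lemma inner_eq_coords (x y : E2) : ⟪x, y⟫ = x 0 * y 0 + x 1 * y 1 := by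
  simp [PiLp.inner_apply, Fin.sum_univ_two, mul_comm]

lemma ae_differentiableAt_of_isOpen {w : E2 → ℝ} {K : NNReal} {U : Set E2} (hU : IsOpen U)
    (hw : LipschitzOnWith K w U) : ∀ᵐ x, x ∈ U → DifferentiableAt ℝ w x := by
  filter_upwards [hw.ae_differentiableWithinAt_of_mem (μ := volume)] with x hx hxU
  exact (hx hxU).differentiableAt (hU.mem_nhds hxU)

lemma exists_mem_segment_frontier {U : Set E2} (hU : IsOpen U) {x y : E2} (hx : x ∈ U)
    (hy : y ∉ U) : ∃ z ∈ segment ℝ x y, z ∈ frontier U := by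
  by_contra! h
  have hsub : segment ℝ x y ⊆ U ∪ (closure U)ᶜ := by
    intro z hz
    by_cases hzU : z ∈ U
    · exact Or.inl hzU
    · refine Or.inr fun hzc => h z hz ?_
      rw [hU.frontier_eq]
      exact ⟨hzc, hzU⟩
  have := (convex_segment x y).isPreconnected.subset_left_of_subset_union hU
    isClosed_closure.isOpen_compl
    (disjoint_compl_right.mono_left subset_closure) hsub ⟨x, left_mem_segment ℝ x y, hx⟩
  exact hy (this (right_mem_segment ℝ x y))

lemma dist_le_of_mem_segment {x y z : E2} (h : z ∈ segment ℝ x y) : dist x z ≤ dist x y := by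
  have := dist_add_dist_of_mem_segment h
  linarith [dist_nonneg (x := z) (y := y)]

lemma lipschitzWith_indicator {U : Set E2} (hU : IsOpen U) {w : E2 → ℝ} {K : NNReal}
    (hw : LipschitzOnWith K w (closure U)) (h0 : ∀ x ∈ frontier U, w x = 0) :
    LipschitzWith K (U.indicator w) := by
  have key : ∀ x ∈ U, ∀ y ∉ U, |w x| ≤ K * dist x y := by
    intro x hx y hy
    obtain ⟨z, hz, hzf⟩ := exists_mem_segment_frontier hU hx hy
    have h1 := hw.dist_le_mul x (subset_closure hx) z (frontier_subset_closure hzf)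
    rw [h0 z hzf, Real.dist_eq, sub_zero] at h1
    exact h1.trans (mul_le_mul_of_nonneg_left (dist_le_of_mem_segment hz) K.2)
  refine LipschitzWith.of_dist_le_mul fun x y => ?_
  by_cases hx : x ∈ U <;> by_cases hy : y ∈ U
  · simp only [indicator_of_mem hx, indicator_of_mem hy]
    exact hw.dist_le_mul x (subset_closure hx) y (subset_closure hy)
  · simp only [indicator_of_mem hx, indicator_of_notMem hy, Real.dist_eq, sub_zero]
    exact key x hx y hy
  · simp only [indicator_of_mem hy, indicator_of_notMem hx, Real.dist_eq, zero_sub, abs_neg]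
    rw [dist_comm]
    exact key y hy x hx
  · simp only [indicator_of_notMem hx, indicator_of_notMem hy, dist_self]
    positivity

/-- A Lipschitz function whose gradient is almost everywhere bounded by `M` on an open convex set
is `M`-Lipschitz there. -/
lemma abs_sub_le_of_ae_norm_gradient_le {V : E2 → ℝ} {K : NNReal} (hV : LipschitzWith K V)
    {S : Set E2} (hS : IsOpen S) (hSc : Convex ℝ S) {M : ℝ}
    (hg : ∀ᵐ z, z ∈ S → ‖gradient V z‖ ≤ M) {x y : E2} (hx : x ∈ S) (hy : y ∈ S) :
    |V y - V x| ≤ M * ‖y - x‖ := by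
  have hseg : IsCompact (segment ℝ x y) := by
    rw [segment_eq_image_lineMap]
    exact isCompact_Icc.image (AffineMap.lineMap_continuous)
  obtain ⟨δ₀, hδ₀, hthick⟩ := hseg.exists_thickening_subset_open hS (hSc.segment_subset hx hy)
  set w := y - x with hw
  have main : ∀ δ, 0 < δ → δ < δ₀ → |V y - V x| ≤ M * ‖w‖ + 2 * K * δ := by
    intro δ hδ hδ'
    set B := ball x δ
    have hBfin : volume B ≠ ⊤ := measure_ball_lt_top.ne
    set vol := volume.real B with hvol
    have hvolpos : 0 < vol := ENNReal.toReal_pos (measure_ball_pos _ _ hδ).ne' hBfin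
    set g : E2 → ℝ := B.indicator 1 with hgdef
    have hgi : Integrable g volume :=
      (integrable_indicator_iff measurableSet_ball).2 (integrableOn_const hBfin)
    have hLip : ∀ t : ℝ, LipschitzWith K (fun z => V (z + t • w)) := fun t => by
      refine LipschitzWith.of_dist_le_mul fun a b => ?_
      simpa using hV.dist_le_mul (a + t • w) (b + t • w)
    set I : ℝ → ℝ := fun t => ∫ z in B, V (z + t • w) with hI
    have hint : ∀ t : ℝ, IntegrableOn (fun z => V (z + t • w)) B := fun t =>
      ((hLip t).continuous.continuousOn.integrableOn_compact
        (isCompact_closedBall x δ)).mono_set ball_subset_closedBall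
    have hmulg : ∀ h : E2 → ℝ, ∫ z, h z * g z = ∫ z in B, h z := by
      intro h
      rw [← integral_indicator measurableSet_ball]
      congr 1
      ext z
      by_cases hz : z ∈ B
      · rw [hgdef, indicator_of_mem hz, indicator_of_mem hz, Pi.one_apply, mul_one]
      · rw [hgdef, indicator_of_notMem hz, indicator_of_notMem hz, mul_zero]
    have hderiv : ∀ t, HasDerivWithinAt I
        (∫ z in B, lineDeriv ℝ (fun z => V (z + t • w)) z w) (Ici t) t := by
      intro t
      have h1 := LipschitzWith.integral_inv_smul_sub_mul_tendsto_integral_lineDeriv_mul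
        (μ := volume) (hLip t) hgi w
      rw [hmulg] at h1
      rw [← hasDerivWithinAt_Ioi_iff_Ici, hasDerivWithinAt_iff_tendsto_slope' (by simp)]
      have h2 : Tendsto (fun s : ℝ => s - t) (𝓝[>] t) (𝓝[>] 0) := by
        refine tendsto_nhdsWithin_iff.2 ⟨?_, ?_⟩
        · have : Tendsto (fun s : ℝ => s - t) (𝓝 t) (𝓝 (t - t)) :=
            (continuous_id.sub continuous_const).tendsto t
          rw [sub_self] at this
          exact this.mono_left nhdsWithin_le_nhds
        · filter_upwards [self_mem_nhdsWithin] with s hs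
          exact sub_pos.2 (mem_Ioi.1 hs)
      refine (h1.comp h2).congr fun s => ?_
      simp only [Function.comp_apply, hmulg]
      rw [slope_def_module, hI, ← integral_sub (hint s) (hint t), ← integral_smul]
      congr 1
      ext z
      simp only [sub_smul, sub_add_cancel, add_assoc]
    have hbound : ∀ t ∈ Ico (0:ℝ) 1,
        ‖∫ z in B, lineDeriv ℝ (fun z => V (z + t • w)) z w‖ ≤ M * ‖w‖ * vol := by
      intro t ht
      refine norm_setIntegral_le_of_norm_le_const_ae measure_ball_lt_top ?_
      rw [ae_restrict_iff' measurableSet_ball]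
      have hq := (measurePreserving_add_right (volume : Measure E2) (t • w)).quasiMeasurePreserving
      filter_upwards [hq.ae hg, hq.ae hV.ae_differentiableAt] with z hz1 hz2 hzB
      have hmem : z + t • w ∈ S := by
        refine hthick ?_
        rw [mem_thickening_iff]
        refine ⟨x + t • w, ?_, by simpa using (mem_ball.1 hzB).trans hδ'⟩
        rw [segment_eq_image']
        exact ⟨t, ⟨ht.1, ht.2.le⟩, rfl⟩
      have : lineDeriv ℝ (fun z => V (z + t • w)) z w = lineDeriv ℝ V (z + t • w) w := by
        simp only [lineDeriv, add_right_comm]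
      rw [this, hz2.lineDeriv_eq_fderiv,
        ← inner_gradient_left (𝕜 := ℝ) (f := V) (x := z + t • w) (y := w)]
      exact (norm_inner_le_norm _ _).trans
        (mul_le_mul_of_nonneg_right (hz1 hmem) (norm_nonneg _))
    have hcont : ContinuousOn I (Icc 0 1) := by
      have hL : LipschitzWith (K * ‖w‖₊ * ⟨vol, hvolpos.le⟩) I := by
        refine LipschitzWith.of_dist_le_mul fun s t => ?_
        rw [Real.dist_eq, hI, ← integral_sub (hint s) (hint t), ← Real.norm_eq_abs]
        have := norm_setIntegral_le_of_norm_le_const (μ := volume) (s := B)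
          (f := fun z => V (z + s • w) - V (z + t • w)) (C := K * ‖w‖ * dist s t)
          measure_ball_lt_top (fun z _ => ?_)
        · refine this.trans (le_of_eq ?_)
          change _ = (K : ℝ) * ‖w‖ * vol * dist s t
          rw [← hvol]
          ring
        · rw [← dist_eq_norm]
          refine (hV.dist_le_mul _ _).trans (le_of_eq ?_)
          rw [dist_add_left, dist_eq_norm, ← sub_smul, norm_smul, Real.dist_eq,
            Real.norm_eq_abs]
          ring
      exact hL.continuous.continuousOn
    have hI01 := norm_image_sub_le_of_norm_deriv_right_le_segment hcont
      (fun t _ => hderiv t) hbound 1 (by simp)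
    have happrox : ∀ t : ℝ, |I t - V (x + t • w) * vol| ≤ K * δ * vol := by
      intro t
      have : V (x + t • w) * vol = ∫ z in B, V (x + t • w) := by
        simp [hvol, mul_comm]
      rw [this, hI, ← integral_sub (hint t) (integrableOn_const hBfin), ← Real.norm_eq_abs]
      refine norm_setIntegral_le_of_norm_le_const measure_ball_lt_top (fun z hz => ?_)
      rw [← dist_eq_norm]
      refine (hV.dist_le_mul _ _).trans ?_
      rw [dist_add_right]
      exact mul_le_mul_of_nonneg_left (mem_ball.1 hz).le K.2
    have h0 := happrox 0
    have h1 := happrox 1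
    have hy' : x + (1:ℝ) • w = y := by simp [hw]
    rw [hy'] at h1
    rw [zero_smul, add_zero] at h0
    rw [Real.norm_eq_abs, sub_zero, mul_one] at hI01
    refine le_of_mul_le_mul_right ?_ hvolpos
    rw [← abs_of_pos hvolpos, ← abs_mul, abs_of_pos hvolpos]
    rw [abs_le] at *
    constructor <;> nlinarith
  refine le_of_forall_pos_le_add fun ε hε => ?_
  have hK : (0:ℝ) ≤ K := K.2
  set δ := min (δ₀ / 2) (ε / (2 * K + 1)) with hδ
  have hδpos : 0 < δ := by positivity
  have h1 := main δ hδpos (by have := min_le_left (δ₀ / 2) (ε / (2 * K + 1)); linarith)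
  have h2 : δ * (2 * K + 1) ≤ ε := by
    rw [← le_div_iff₀ (by positivity)]
    exact min_le_right _ _
  nlinarith

/-- The radial vector field `p ↦ h(‖p‖) p / ‖p‖`. -/
def radial (h : ℝ → ℝ) (p : E2) : E2 := (h ‖p‖ / ‖p‖) • p

lemma norm_radial {h : ℝ → ℝ} (h0 : h 0 = 0) {p : E2} (hn : 0 ≤ h ‖p‖) :
    ‖radial h p‖ = h ‖p‖ := by
  rcases eq_or_ne p 0 with rfl | hp
  · simp [radial, h0]
  · have : ‖p‖ ≠ 0 := norm_ne_zero_iff.2 hp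
    rw [radial, norm_smul, Real.norm_eq_abs, abs_of_nonneg (by positivity)]
    field_simp

lemma radial_neg (h : ℝ → ℝ) (p : E2) : radial h (-p) = -radial h p := by
  simp [radial]

lemma continuous_radial {h : ℝ → ℝ} (hc : ContinuousOn h (Ici 0)) (h0 : h 0 = 0)
    (hn : ∀ r, 0 ≤ r → 0 ≤ h r) : Continuous (radial h) := by
  have hcn : Continuous fun p : E2 => h ‖p‖ :=
    hc.comp_continuous continuous_norm fun p => norm_nonneg p
  rw [continuous_iff_continuousAt]
  intro p
  rcases eq_or_ne p 0 with rfl | hp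
  · have : radial h 0 = 0 := by simp [radial]
    rw [ContinuousAt, this, tendsto_zero_iff_norm_tendsto_zero]
    simp only [fun q : E2 => norm_radial h0 (hn ‖q‖ (norm_nonneg q))]
    simpa [h0] using hcn.tendsto 0
  · exact (hcn.continuousAt.div continuous_norm.continuousAt (norm_ne_zero_iff.2 hp)).smul
      continuousAt_id

lemma inner_radial_sub_pos {h : ℝ → ℝ} (hm : StrictMonoOn h (Ici 0)) (h0 : h 0 = 0)
    {p q : E2} (hpq : p ≠ q) : 0 < ⟪radial h p - radial h q, p - q⟫ := by
  have hnn : ∀ r, 0 ≤ r → 0 ≤ h r := fun r hr => by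
    rw [← h0]; exact hm.monotoneOn self_mem_Ici hr hr
  have key : ∀ p : E2, h ‖p‖ / ‖p‖ * ‖p‖ = h ‖p‖ := by
    intro p
    rcases eq_or_ne p 0 with rfl | hp
    · simp [h0]
    · exact div_mul_cancel₀ _ (norm_ne_zero_iff.2 hp)
  have kp := key p
  have kq := key q
  have hap : 0 ≤ h ‖p‖ / ‖p‖ := div_nonneg (hnn _ (norm_nonneg _)) (norm_nonneg _)
  have haq : 0 ≤ h ‖q‖ / ‖q‖ := div_nonneg (hnn _ (norm_nonneg _)) (norm_nonneg _)
  have hcs := real_inner_le_norm p q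
  have e : ⟪radial h p - radial h q, p - q⟫ = h ‖p‖ / ‖p‖ * ‖p‖ ^ 2 + h ‖q‖ / ‖q‖ * ‖q‖ ^ 2
      - (h ‖p‖ / ‖p‖ + h ‖q‖ / ‖q‖) * ⟪p, q⟫ := by
    simp only [radial, inner_sub_left, inner_sub_right, real_inner_smul_left,
      real_inner_self_eq_norm_sq, real_inner_comm p q]
    ring
  rw [e]
  set a := h ‖p‖ / ‖p‖
  set b := h ‖q‖ / ‖q‖
  rcases eq_or_ne ‖p‖ ‖q‖ with hn | hn
  · have hab : a = b := by simp only [a, b, hn]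
    have hq : 0 < ‖q‖ := by
      rcases (norm_nonneg q).lt_or_eq with h | h
      · exact h
      · exact absurd ((norm_eq_zero.1 (hn.trans h.symm)).trans (norm_eq_zero.1 h.symm).symm) hpq
    have hb : 0 < b := div_pos (by rw [← h0]; exact hm self_mem_Ici hq.le hq) hq
    have hlt : ⟪p, q⟫ < ‖q‖ ^ 2 := by
      have h1 : 0 < ‖p - q‖ ^ 2 := by
        have := norm_pos_iff.2 (sub_ne_zero.2 hpq)
        positivity
      rw [@norm_sub_sq_real, hn] at h1
      linarith
    rw [hab, hn]
    nlinarith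
  · have h1 : 0 < (h ‖p‖ - h ‖q‖) * (‖p‖ - ‖q‖) := by
      rcases lt_or_gt_of_ne hn with hlt | hlt
      · exact mul_pos_of_neg_of_neg (sub_neg.2 (hm (norm_nonneg _) (norm_nonneg _) hlt))
          (sub_neg.2 hlt)
      · exact mul_pos (sub_pos.2 (hm (norm_nonneg _) (norm_nonneg _) hlt)) (sub_pos.2 hlt)
    have h2 : (a + b) * ⟪p, q⟫ ≤ (a + b) * (‖p‖ * ‖q‖) :=
      mul_le_mul_of_nonneg_left hcs (by positivity)
    rw [← kp, ← kq] at h1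
    nlinarith

/-- Nonnegative Lipschitz test functions vanishing outside `U`. -/
structure IsTestFn (U : Set E2) (η : E2 → ℝ) : Prop where
  lip : ∃ K, LipschitzWith K η
  nonneg : ∀ x, 0 ≤ η x
  eq_zero : ∀ x ∉ U, η x = 0

lemma IsTestFn.mono {U U' : Set E2} {η : E2 → ℝ} (h : IsTestFn U η) (hU : U ⊆ U') :
    IsTestFn U' η :=
  ⟨h.lip, h.nonneg, fun x hx => h.eq_zero x fun h' => hx (hU h')⟩

lemma IsTestFn.gradient_eq_zero {U : Set E2} {η : E2 → ℝ} (h : IsTestFn U η) {x : E2}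
    (hx : x ∉ U) : gradient η x = 0 :=
  gradient_eq_zero_of_nonneg h.nonneg (h.eq_zero x hx)

lemma IsTestFn.hasCompactSupport {U : Set E2} {η : E2 → ℝ} (h : IsTestFn U η)
    (hU : Bornology.IsBounded U) : HasCompactSupport η :=
  HasCompactSupport.intro hU.isCompact_closure fun x hx =>
    h.eq_zero x fun h' => hx (subset_closure h')

lemma IsTestFn.integrable_inner {U : Set E2} {η : E2 → ℝ} (h : IsTestFn U η) (hU : IsOpen U)
    (hb : Bornology.IsBounded U) {X : E2 → E2} (hX : Measurable X) {C : ℝ}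
    (hC : ∀ x ∈ U, ‖X x‖ ≤ C) :
    Integrable fun x => ⟪X x, gradient η x⟫ := by
  obtain ⟨L, hL⟩ := h.lip
  have hs : Function.support (fun x => ⟪X x, gradient η x⟫) ⊆ U := by
    intro x hx
    by_contra hxU
    exact hx (by simp [h.gradient_eq_zero hxU])
  rw [← integrableOn_iff_integrable_of_support_subset hs]
  refine Measure.integrableOn_of_bounded (M := C * L) hb.measure_lt_top.ne
    (hX.inner (measurable_gradient η)).aestronglyMeasurable ?_
  rw [ae_restrict_iff' hU.measurableSet]
  refine Eventually.of_forall fun x hx => (norm_inner_le_norm _ _).trans ?_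
  exact mul_le_mul (hC x hx) (norm_gradient_le hL.lipschitzOnWith univ_mem) (norm_nonneg _)
    ((norm_nonneg _).trans (hC x hx))

lemma exists_norm_comp_gradient_le {G : E2 → E2} (hG : Continuous G) {U : Set E2} (hU : IsOpen U)
    {w : E2 → ℝ} (hw : LipOn w U) : ∃ C, ∀ x ∈ U, ‖G (gradient w x)‖ ≤ C := by
  obtain ⟨K, hK⟩ := hw
  obtain ⟨C, hC⟩ := (isCompact_closedBall (0 : E2) K).exists_bound_of_continuousOn hG.continuousOn
  exact ⟨C, fun x hx => hC _ (by simpa using norm_gradient_le hK (hU.mem_nhds hx))⟩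

lemma LipOn.mono {w : E2 → ℝ} {s t : Set E2} (h : LipOn w s) (hts : t ⊆ s) : LipOn w t :=
  let ⟨K, hK⟩ := h
  ⟨K, hK.mono hts⟩

/-- Weak comparison principle for a strictly monotone field. -/
lemma le_of_weak_le {G : E2 → E2} (hG : Continuous G)
    (hmono : ∀ p q, p ≠ q → 0 < ⟪G p - G q, p - q⟫)
    {U : Set E2} (hU : IsOpen U) (hb : Bornology.IsBounded U) {w₁ w₂ : E2 → ℝ}
    (h₁ : LipOn w₁ (closure U)) (h₂ : LipOn w₂ (closure U))
    (hbd : ∀ x ∈ frontier U, w₁ x ≤ w₂ x)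
    (hweak : ∀ η, IsTestFn U η →
      ∫ x, ⟪G (gradient w₁ x), gradient η x⟫ ≤ ∫ x, ⟪G (gradient w₂ x), gradient η x⟫) :
    ∀ x ∈ U, w₁ x ≤ w₂ x := by
  obtain ⟨K₁, hK₁⟩ := h₁
  obtain ⟨K₂, hK₂⟩ := h₂
  set η : E2 → ℝ := U.indicator (fun x => max (w₁ x - w₂ x) 0) with hη
  have hηL : LipschitzWith (K₁ + K₂) η := by
    refine lipschitzWith_indicator hU ?_ fun x hx => max_eq_right (sub_nonpos.2 (hbd x hx))
    have := (hK₁.sub hK₂)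
    refine LipschitzOnWith.of_dist_le_mul fun x hx y hy => ?_
    refine le_trans ?_ (this.dist_le_mul x hx y hy)
    rw [Real.dist_eq, Real.dist_eq]
    exact abs_max_sub_max_le_abs _ _ _
  have htest : IsTestFn U η :=
    ⟨⟨_, hηL⟩, fun x => indicator_nonneg (fun _ _ => le_max_right _ _) _,
      fun x hx => indicator_of_notMem hx _⟩
  have m₁ : Measurable fun x => G (gradient w₁ x) := hG.measurable.comp (measurable_gradient w₁)
  have m₂ : Measurable fun x => G (gradient w₂ x) := hG.measurable.comp (measurable_gradient w₂)
  obtain ⟨C₁, hC₁⟩ := exists_norm_comp_gradient_le hG hU ⟨K₁, hK₁.mono subset_closure⟩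
  obtain ⟨C₂, hC₂⟩ := exists_norm_comp_gradient_le hG hU ⟨K₂, hK₂.mono subset_closure⟩
  have i₁ := htest.integrable_inner hU hb m₁ hC₁
  have i₂ := htest.integrable_inner hU hb m₂ hC₂
  have hgrad : ∀ᵐ x, gradient η x = 0 ∨ gradient η x = gradient w₁ x - gradient w₂ x := by
    filter_upwards [ae_differentiableAt_of_isOpen hU (hK₁.mono subset_closure),
      ae_differentiableAt_of_isOpen hU (hK₂.mono subset_closure)] with x hx₁ hx₂
    by_cases hx0 : η x = 0
    · exact Or.inl (gradient_eq_zero_of_nonneg htest.nonneg hx0)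
    · have hxU : x ∈ U := by
        by_contra h
        exact hx0 (htest.eq_zero x h)
      have hlt : w₂ x < w₁ x := by
        by_contra! h
        exact hx0 (by rw [hη, indicator_of_mem hxU]; exact max_eq_right (sub_nonpos.2 h))
      right
      have hev : η =ᶠ[𝓝 x] fun y => w₁ y - w₂ y := by
        filter_upwards [hU.mem_nhds hxU,
          (hx₂ hxU).continuousAt.eventually_lt (hx₁ hxU).continuousAt hlt] with y hyU hy
        rw [hη, indicator_of_mem hyU]
        exact max_eq_left (sub_pos.2 hy).le
      rw [hev.gradient_eq]
      simp only [gradient]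
      rw [fderiv_fun_sub (hx₁ hxU) (hx₂ hxU), map_sub]
  have hnn : ∀ᵐ x, 0 ≤ ⟪G (gradient w₁ x) - G (gradient w₂ x), gradient η x⟫ := by
    filter_upwards [hgrad] with x hx
    rcases hx with hx | hx
    · simp [hx]
    · rw [hx]
      rcases eq_or_ne (gradient w₁ x) (gradient w₂ x) with h | h
      · simp [h]
      · exact (hmono _ _ h).le
  have hsub : (fun x => ⟪G (gradient w₁ x) - G (gradient w₂ x), gradient η x⟫) =
      fun x => ⟪G (gradient w₁ x), gradient η x⟫ - ⟪G (gradient w₂ x), gradient η x⟫ := by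
    ext x; rw [inner_sub_left]
  have hint : ∫ x, ⟪G (gradient w₁ x) - G (gradient w₂ x), gradient η x⟫ = 0 := by
    refine le_antisymm ?_ (integral_nonneg_of_ae hnn)
    rw [hsub, integral_sub i₁ i₂]
    exact sub_nonpos.2 (hweak η htest)
  rw [integral_eq_zero_iff_of_nonneg_ae hnn (by rw [hsub]; exact i₁.sub i₂)] at hint
  have hzero : ∀ᵐ x, x ∈ (univ : Set E2) → ‖gradient η x‖ ≤ 0 := by
    filter_upwards [hint, hgrad] with x hx1 hx2 _
    rcases hx2 with hx2 | hx2
    · simp [hx2]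
    · rw [hx2] at hx1 ⊢
      rcases eq_or_ne (gradient w₁ x) (gradient w₂ x) with h | h
      · simp [h]
      · exact absurd hx1 (hmono _ _ h).ne'
  obtain ⟨y, hy⟩ : ∃ y, y ∉ U := by
    by_contra! h
    exact NormedSpace.unbounded_univ ℝ E2 (hb.subset fun x _ => h x)
  intro x hx
  have := abs_sub_le_of_ae_norm_gradient_le hηL isOpen_univ convex_univ hzero
    (mem_univ y) (mem_univ x)
  rw [zero_mul, htest.eq_zero y hy, sub_zero] at this
  have h0 : η x = 0 := abs_eq_zero.1 (le_antisymm this (abs_nonneg _))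
  rw [hη, indicator_of_mem hx] at h0
  exact sub_nonpos.1 (le_of_max_le_left h0.le)

/-- `w` solves `div G(∇w) = 0` weakly in `U`. -/
def WeakSol (G : E2 → E2) (U : Set E2) (w : E2 → ℝ) : Prop :=
  ∀ η, IsTestFn U η → ∫ x, ⟪G (gradient w x), gradient η x⟫ = 0

/-- Convex `C¹` Lagrangians on `[0,∞)` with strictly increasing derivative vanishing at `0`. -/
structure IsLagrangian (f : ℝ → ℝ) : Prop where
  convex : ConvexOn ℝ (Ici 0) f
  contDiff : ContDiffOn ℝ 1 f (Ici 0)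
  dtop_zero : dtop f 0 = 0
  strictMono : StrictMonoOn (dtop f) (Ici 0)

namespace IsLagrangian

variable {f : ℝ → ℝ}

lemma continuousOn_dtop (hf : IsLagrangian f) : ContinuousOn (dtop f) (Ici 0) :=
  hf.contDiff.continuousOn_derivWithin (uniqueDiffOn_Ici 0) le_rfl

lemma dtop_nonneg (hf : IsLagrangian f) {r : ℝ} (hr : 0 ≤ r) : 0 ≤ dtop f r := by
  rw [← hf.dtop_zero]
  exact hf.strictMono.monotoneOn self_mem_Ici hr hr

lemma continuous_radial_dtop (hf : IsLagrangian f) : Continuous (radial (dtop f)) :=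
  continuous_radial hf.continuousOn_dtop hf.dtop_zero fun _ => hf.dtop_nonneg

lemma inner_radial_sub_pos (hf : IsLagrangian f) (p q : E2) (hpq : p ≠ q) :
    0 < ⟪radial (dtop f) p - radial (dtop f) q, p - q⟫ :=
  _root_.inner_radial_sub_pos hf.strictMono hf.dtop_zero hpq

lemma add_dtop_mul_le (hf : IsLagrangian f) {r s : ℝ} (hr : 0 ≤ r) (hs : 0 ≤ s) :
    f r + dtop f r * (s - r) ≤ f s := by
  have hd : DifferentiableWithinAt ℝ f (Ici 0) r := hf.contDiff.differentiableOn one_ne_zero r hr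
  rcases lt_trichotomy r s with h | rfl | h
  · have := hf.convex.derivWithin_le_slope hr hs h hd
    rw [slope_def_field, le_div_iff₀ (sub_pos.2 h)] at this
    unfold dtop
    linarith
  · simp
  · have := hf.convex.slope_le_derivWithin hs hr h hd
    rw [slope_def_field, div_le_iff₀ (sub_pos.2 h)] at this
    unfold dtop
    linarith

lemma sub_le_inner_radial (hf : IsLagrangian f) (p q : E2) :
    f ‖p‖ - f ‖q‖ ≤ ⟪radial (dtop f) p, p - q⟫ := by
  have h1 := hf.add_dtop_mul_le (norm_nonneg p) (norm_nonneg q)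
  have h2 := real_inner_le_norm p q
  have h3 := hf.dtop_nonneg (norm_nonneg p)
  have key : dtop f ‖p‖ / ‖p‖ * ‖p‖ = dtop f ‖p‖ := by
    rcases eq_or_ne p 0 with rfl | hp
    · simp [hf.dtop_zero]
    · exact div_mul_cancel₀ _ (norm_ne_zero_iff.2 hp)
  have h4 : 0 ≤ dtop f ‖p‖ / ‖p‖ := div_nonneg h3 (norm_nonneg p)
  rw [radial, real_inner_smul_left, inner_sub_right, real_inner_self_eq_norm_sq]
  have h5 := mul_le_mul_of_nonneg_left h2 h4
  rw [← key] at h1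
  nlinarith

lemma integrableOn_comp_norm_gradient (hf : IsLagrangian f) {U : Set E2} (hU : IsOpen U)
    (hb : Bornology.IsBounded U) {w : E2 → ℝ} (hw : LipOn w U) :
    IntegrableOn (fun x => f ‖gradient w x‖) U := by
  obtain ⟨K, hK⟩ := hw
  have hfc : ContinuousOn f (Ici 0) := hf.contDiff.continuousOn
  have hc : Continuous fun p : E2 => f ‖p‖ :=
    hfc.comp_continuous continuous_norm fun p => norm_nonneg p
  obtain ⟨C, hC⟩ := (isCompact_closedBall (0 : E2) K).exists_bound_of_continuousOn hc.continuousOn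
  refine Measure.integrableOn_of_bounded (M := C) hb.measure_lt_top.ne
    (hc.measurable.comp (measurable_gradient w)).aestronglyMeasurable ?_
  rw [ae_restrict_iff' hU.measurableSet]
  exact Eventually.of_forall fun x hx =>
    hC _ (by simpa using norm_gradient_le hK (hU.mem_nhds hx))

lemma setIntegral_inner_nonneg (hf : IsLagrangian f) {Ω : Set E2} (hΩ : IsOpen Ω)
    (hb : Bornology.IsBounded Ω) {ψ u : E2 → ℝ} (hu : SolvesP f Ω ψ u) {η : E2 → ℝ} {L : NNReal}
    (hη : LipschitzWith L η) (h0 : ∀ x ∉ Ω, η x = 0) :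
    0 ≤ ∫ x in Ω, ⟪radial (dtop f) (gradient u x), gradient η x⟫ := by
  obtain ⟨⟨K, hK⟩, hbd, hmin⟩ := hu
  have hKΩ := hK.mono (subset_closure (s := Ω))
  have hGc := hf.continuous_radial_dtop
  set G := radial (dtop f)
  obtain ⟨C, hC⟩ := (isCompact_closedBall (0 : E2) (K + L)).exists_bound_of_continuousOn
    hGc.continuousOn
  have hbound : ∀ t ∈ Ioo (0:ℝ) 1, ∀ᵐ x ∂volume.restrict Ω,
      ‖⟪G (gradient u x + t • gradient η x), gradient η x⟫‖ ≤ C * L := by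
    intro t ht
    rw [ae_restrict_iff' hΩ.measurableSet]
    refine Eventually.of_forall fun x hx => (norm_inner_le_norm _ _).trans ?_
    have hg1 := norm_gradient_le hKΩ (hΩ.mem_nhds hx)
    have hg2 : ‖gradient η x‖ ≤ L := norm_gradient_le hη.lipschitzOnWith univ_mem
    have hmem : ‖gradient u x + t • gradient η x‖ ≤ K + L := by
      refine (norm_add_le _ _).trans (add_le_add hg1 ?_)
      rw [norm_smul, Real.norm_eq_abs, abs_of_pos ht.1]
      nlinarith [ht.2, norm_nonneg (gradient η x), ht.1]
    have := hC _ (by simpa using hmem)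
    exact mul_le_mul this hg2 (norm_nonneg _) ((norm_nonneg _).trans this)
  have hmeas : ∀ t : ℝ, Measurable fun x =>
      ⟪G (gradient u x + t • gradient η x), gradient η x⟫ := fun t =>
    (hGc.measurable.comp ((measurable_gradient u).add
      ((measurable_gradient η).const_smul t))).inner (measurable_gradient η)
  have hpos : ∀ t ∈ Ioo (0:ℝ) 1,
      0 ≤ ∫ x in Ω, ⟪G (gradient u x + t • gradient η x), gradient η x⟫ := by
    intro t ht
    set ut : E2 → ℝ := fun x => u x + t * η x with hut
    have hutL : LipOn ut (closure Ω) :=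
      ⟨_, hK.add ((LipschitzWith.of_dist_le_mul (K := Real.toNNReal t * L) fun x y => by
        have := hη.dist_le_mul x y
        rw [Real.dist_eq] at this ⊢
        rw [← mul_sub, abs_mul, abs_of_pos ht.1, NNReal.coe_mul,
          Real.coe_toNNReal _ ht.1.le, mul_assoc]
        exact mul_le_mul_of_nonneg_left this ht.1.le).lipschitzOnWith)⟩
    have hutb : EqOn ut ψ (frontier Ω) := by
      intro x hx
      have : x ∉ Ω := by
        rw [hΩ.frontier_eq] at hx
        exact hx.2
      simp [hut, h0 x this, hbd hx]
    have hJ := hmin ut hutL hutb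
    have i1 := hf.integrableOn_comp_norm_gradient hΩ hb (hutL.mono subset_closure)
    have i2 := hf.integrableOn_comp_norm_gradient hΩ hb ⟨K, hKΩ⟩
    have i3 : IntegrableOn
        (fun x => ⟪G (gradient u x + t • gradient η x), gradient η x⟫) Ω :=
      Measure.integrableOn_of_bounded (M := C * L) hb.measure_lt_top.ne
        (hmeas t).aestronglyMeasurable (hbound t ht)
    have hle : (∫ x in Ω, f ‖gradient ut x‖) - ∫ x in Ω, f ‖gradient u x‖ ≤
        t * ∫ x in Ω, ⟪G (gradient u x + t • gradient η x), gradient η x⟫ := by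
      rw [← integral_sub i1 i2, ← integral_const_mul]
      refine integral_mono_ae (i1.sub i2) (i3.const_mul t) ?_
      rw [EventuallyLE, ae_restrict_iff' hΩ.measurableSet]
      filter_upwards [ae_differentiableAt_of_isOpen hΩ hKΩ, hη.ae_differentiableAt] with x h1 h2 hx
      have hg : gradient ut x = gradient u x + t • gradient η x := by
        simp only [gradient, hut]
        rw [fderiv_fun_add (h1 hx) (h2.const_mul t), fderiv_const_mul h2, map_add, map_smul]
      have := hf.sub_le_inner_radial (gradient ut x) (gradient u x)
      rw [hg, add_sub_cancel_left, real_inner_smul_right] at this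
      simpa [hg] using this
    unfold J at hJ
    have : 0 ≤ t * ∫ x in Ω, ⟪G (gradient u x + t • gradient η x), gradient η x⟫ := by linarith
    exact nonneg_of_mul_nonneg_right this ht.1
  have hlim : Tendsto (fun t : ℝ =>
      ∫ x in Ω, ⟪G (gradient u x + t • gradient η x), gradient η x⟫) (𝓝[>] 0)
      (𝓝 (∫ x in Ω, ⟪G (gradient u x), gradient η x⟫)) := by
    refine tendsto_integral_filter_of_dominated_convergence (fun _ => C * L)
      (Eventually.of_forall fun t => (hmeas t).aestronglyMeasurable) ?_
      (integrableOn_const hb.measure_lt_top.ne) (Eventually.of_forall fun x => ?_)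
    · filter_upwards [Ioo_mem_nhdsGT (zero_lt_one' ℝ)] with t ht using hbound t ht
    · have hcx : Continuous fun t : ℝ =>
          ⟪G (gradient u x + t • gradient η x), gradient η x⟫ := by fun_prop
      have := hcx.tendsto 0
      simp only [zero_smul, add_zero] at this
      exact this.mono_left nhdsWithin_le_nhds
  refine ge_of_tendsto hlim ?_
  filter_upwards [Ioo_mem_nhdsGT (zero_lt_one' ℝ)] with t ht using hpos t ht

lemma weakSol (hf : IsLagrangian f) {Ω : Set E2} (hΩ : IsOpen Ω)
    (hb : Bornology.IsBounded Ω) {ψ u : E2 → ℝ} (hu : SolvesP f Ω ψ u) :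
    WeakSol (radial (dtop f)) Ω u := by
  intro η hη
  obtain ⟨L, hL⟩ := hη.lip
  rw [← setIntegral_eq_integral_of_forall_compl_eq_zero (s := Ω)
    (fun x hx => by simp [hη.gradient_eq_zero hx])]
  refine le_antisymm ?_ (hf.setIntegral_inner_nonneg hΩ hb hu hL hη.eq_zero)
  have := hf.setIntegral_inner_nonneg hΩ hb hu (η := fun x => -η x) (L := L)
    (LipschitzWith.of_dist_le_mul fun x y => by rw [dist_neg_neg]; exact hL.dist_le_mul x y)
    (fun x hx => by simp [hη.eq_zero x hx])
  simp only [gradient_neg_fun, inner_neg_right, integral_neg] at this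
  linarith

end IsLagrangian

lemma gradient_affine (a : E2) (c : ℝ) (x : E2) : gradient (fun y => ⟪a, y⟫ + c) x = a := by
  have h : HasGradientAt (fun y : E2 => ⟪a, y⟫ + c) a x := by
    rw [hasGradientAt_iff_hasFDerivAt]
    exact ((innerSL ℝ a).hasFDerivAt (x := x)).add_const c
  exact h.gradient

lemma lipOn_affine (a : E2) (c : ℝ) (s : Set E2) : LipOn (fun y => ⟪a, y⟫ + c) s :=
  ⟨‖a‖₊, LipschitzOnWith.of_dist_le_mul fun x _ y _ => by
    rw [dist_add_right, Real.dist_eq, ← inner_sub_right, dist_eq_norm, coe_nnnorm]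
    exact abs_real_inner_le_norm _ _⟩

lemma inner_gradient_eq_lineDeriv {w : E2 → ℝ} {x : E2} (h : DifferentiableAt ℝ w x) (v : E2) :
    ⟪v, gradient w x⟫ = lineDeriv ℝ w x v := by
  rw [h.lineDeriv_eq_fderiv, real_inner_comm]
  exact inner_gradient_left

lemma integral_inner_const_gradient {U : Set E2} (hb : Bornology.IsBounded U) {η : E2 → ℝ}
    (hη : IsTestFn U η) (a : E2) : ∫ x, ⟪a, gradient η x⟫ = 0 := by
  obtain ⟨L, hL⟩ := hη.lip
  have h := LipschitzWith.integral_lineDeriv_mul_eq (μ := volume)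
    (LipschitzWith.const (1 : ℝ)) hL (hη.hasCompactSupport hb) (-a)
  have h1 : ∀ x : E2, lineDeriv ℝ (fun _ : E2 => (1 : ℝ)) x (-a) = 0 := fun x => by
    simp [lineDeriv]
  simp only [h1, zero_mul, integral_zero, neg_neg, mul_one] at h
  rw [h]
  refine integral_congr_ae ?_
  filter_upwards [hL.ae_differentiableAt] with x hx using inner_gradient_eq_lineDeriv hx a

lemma weakSol_affine (G : E2 → E2) {U : Set E2} (hb : Bornology.IsBounded U) (a : E2) (c : ℝ) :
    WeakSol G U (fun y => ⟪a, y⟫ + c) := by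
  intro η hη
  simp only [gradient_affine]
  exact integral_inner_const_gradient hb hη _

lemma le_of_weakSol {G : E2 → E2} (hG : Continuous G)
    (hmono : ∀ p q, p ≠ q → 0 < ⟪G p - G q, p - q⟫)
    {U : Set E2} (hU : IsOpen U) (hb : Bornology.IsBounded U) {w₁ w₂ : E2 → ℝ}
    (h₁ : LipOn w₁ (closure U)) (h₂ : LipOn w₂ (closure U))
    (hs₁ : WeakSol G U w₁) (hs₂ : WeakSol G U w₂)
    (hbd : ∀ x ∈ frontier U, w₁ x ≤ w₂ x) : ∀ x ∈ U, w₁ x ≤ w₂ x :=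
  le_of_weak_le hG hmono hU hb h₁ h₂ hbd fun η hη => by rw [hs₁ η hη, hs₂ η hη]

/-- Barriers from the bounded slope condition persist inside the domain. -/
lemma affine_le_weakSol_le {G : E2 → E2} (hG : Continuous G)
    (hmono : ∀ p q, p ≠ q → 0 < ⟪G p - G q, p - q⟫)
    {Ω : Set E2} (hΩ : IsOpen Ω) (hb : Bornology.IsBounded Ω) {u ψ : E2 → ℝ}
    (hL : LipOn u (closure Ω)) (hs : WeakSol G Ω u) (hψ : EqOn u ψ (frontier Ω))
    {a b : E2} {c d : ℝ}
    (hab : ∀ x ∈ frontier Ω, ⟪a, x⟫ + c ≤ ψ x ∧ ψ x ≤ ⟪b, x⟫ + d) :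
    ∀ x ∈ closure Ω, ⟪a, x⟫ + c ≤ u x ∧ u x ≤ ⟪b, x⟫ + d := by
  intro x hx
  by_cases hxΩ : x ∈ Ω
  · exact ⟨le_of_weakSol hG hmono hΩ hb (lipOn_affine a c _) hL (weakSol_affine G hb a c) hs
        (fun y hy => by rw [hψ hy]; exact (hab y hy).1) x hxΩ,
      le_of_weakSol hG hmono hΩ hb hL (lipOn_affine b d _) hs (weakSol_affine G hb b d)
        (fun y hy => by rw [hψ hy]; exact (hab y hy).2) x hxΩ⟩
  · have hf : x ∈ frontier Ω := by rw [hΩ.frontier_eq]; exact ⟨hx, hxΩ⟩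
    rw [hψ hf]
    exact hab x hf

/-- Reduction of interior Lipschitz bounds to the boundary by translation. -/
lemma sub_le_of_weakSol {G : E2 → E2} (hG : Continuous G)
    (hmono : ∀ p q, p ≠ q → 0 < ⟪G p - G q, p - q⟫)
    {Ω : Set E2} (hΩ : IsOpen Ω) (hb : Bornology.IsBounded Ω) {u : E2 → ℝ}
    (hL : LipOn u (closure Ω)) (hs : WeakSol G Ω u) {Q : ℝ}
    (hbd : ∀ x ∈ closure Ω, ∀ y ∈ frontier Ω, |u x - u y| ≤ Q * ‖x - y‖) :
    ∀ x ∈ Ω, ∀ y ∈ Ω, u y - u x ≤ Q * ‖y - x‖ := by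
  intro x hx y hy
  set τ := y - x with hτ
  set U := Ω ∩ (fun z => z + τ) ⁻¹' Ω with hUdef
  have hcτ : Continuous fun z : E2 => z + τ := continuous_id.add continuous_const
  have hU : IsOpen U := hΩ.inter (hΩ.preimage hcτ)
  have hcl : ∀ z ∈ closure U, z ∈ closure Ω ∧ z + τ ∈ closure Ω := fun z hz =>
    ⟨closure_mono inter_subset_left hz,
      (hcτ.closure_preimage_subset Ω) (closure_mono inter_subset_right hz)⟩
  obtain ⟨K, hK⟩ := hL
  have hw₁ : LipOn (fun z => u (z + τ)) (closure U) :=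
    ⟨K, LipschitzOnWith.of_dist_le_mul fun z hz z' hz' => by
      simpa using hK.dist_le_mul _ (hcl z hz).2 _ (hcl z' hz').2⟩
  have hw₂ : LipOn (fun z => u z + Q * ‖τ‖) (closure U) :=
    ⟨K, LipschitzOnWith.of_dist_le_mul fun z hz z' hz' => by
      simpa using hK.dist_le_mul _ (hcl z hz).1 _ (hcl z' hz').1⟩
  have hs₁ : WeakSol G U (fun z => u (z + τ)) := by
    intro η hη
    obtain ⟨L, hL⟩ := hη.lip
    have hg : ∀ (w : E2 → ℝ) (σ z : E2),
        gradient (fun z => w (z + σ)) z = gradient w (z + σ) := fun w σ z => by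
      simp only [gradient]; rw [fderiv_comp_add_right]
    have ht : IsTestFn Ω (fun z => η (z + -τ)) := by
      refine ⟨⟨L, LipschitzWith.of_dist_le_mul fun z z' => by
        simpa using hL.dist_le_mul (z + -τ) (z' + -τ)⟩, fun z => hη.nonneg _, fun z hz => ?_⟩
      exact hη.eq_zero _ fun h => hz (by simpa using h.2)
    have := hs _ ht
    rw [← integral_add_right_eq_self _ τ] at this
    simpa only [hg, add_neg_cancel_right] using this
  have hs₂ : WeakSol G U (fun z => u z + Q * ‖τ‖) := by
    intro η hη
    have hg : ∀ z, gradient (fun z => u z + Q * ‖τ‖) z = gradient u z := fun z => by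
      simp only [gradient, fderiv_add_const]
    simp only [hg]
    exact hs η (hη.mono inter_subset_left)
  have key := le_of_weakSol hG hmono hU (hb.subset inter_subset_left) hw₁ hw₂ hs₁ hs₂ ?_ x
    ⟨hx, by simpa [hτ] using hy⟩
  · have e : x + τ = y := by simp [hτ]
    simp only [e] at key
    linarith
  · intro z hz
    obtain ⟨hz1, hz2⟩ := hcl z (frontier_subset_closure hz)
    rw [hU.frontier_eq] at hz
    have habs : |u (z + τ) - u z| ≤ Q * ‖τ‖ := by
      by_cases hzΩ : z ∈ Ω
      · have hzf : z + τ ∈ frontier Ω := by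
          rw [hΩ.frontier_eq]
          exact ⟨hz2, fun h => hz.2 ⟨hzΩ, h⟩⟩
        have := hbd z hz1 _ hzf
        rw [abs_sub_comm]
        simpa [norm_neg] using this
      · have hzf : z ∈ frontier Ω := by
          rw [hΩ.frontier_eq]
          exact ⟨hz1, hzΩ⟩
        simpa using hbd _ hz2 z hzf
    have := (abs_le.1 habs).2
    linarith

/-- Under the bounded slope condition, weak solutions are `Q`-Lipschitz. -/
lemma lipschitzOnWith_of_BSC {G : E2 → E2} (hG : Continuous G)
    (hmono : ∀ p q, p ≠ q → 0 < ⟪G p - G q, p - q⟫)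
    {Ω : Set E2} (hΩ : IsOpen Ω) (hb : Bornology.IsBounded Ω) {u ψ : E2 → ℝ}
    (hL : LipOn u (closure Ω)) (hs : WeakSol G Ω u) (hψ : EqOn u ψ (frontier Ω))
    {Q : NNReal} (hbsc : BSC Ω ψ Q) : LipschitzOnWith Q u Ω := by
  have hbd : ∀ x ∈ closure Ω, ∀ y ∈ frontier Ω, |u x - u y| ≤ Q * ‖x - y‖ := by
    intro x hx y hy
    obtain ⟨a, b, c, d, ha, hb', hab, hay, hby⟩ := hbsc y hy
    obtain ⟨h1, h2⟩ := affine_le_weakSol_le hG hmono hΩ hb hL hs hψ hab x hx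
    have ha' := (abs_le.1 (abs_real_inner_le_norm a (x - y))).1
    have hb'' := (abs_le.1 (abs_real_inner_le_norm b (x - y))).2
    have ha2 := mul_le_mul_of_nonneg_right ha (norm_nonneg (x - y))
    have hb2 := mul_le_mul_of_nonneg_right hb' (norm_nonneg (x - y))
    rw [inner_sub_right] at ha' hb''
    rw [hψ hy, abs_le]
    constructor <;> linarith
  have key := sub_le_of_weakSol hG hmono hΩ hb hL hs hbd
  refine LipschitzOnWith.of_dist_le_mul fun x hx y hy => ?_
  rw [Real.dist_eq, dist_eq_norm, abs_le]
  have h1 := key x hx y hy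
  have h2 := key y hy x hx
  rw [norm_sub_rev] at h1
  constructor <;> linarith

lemma lineDeriv_eq_zero_of_notMem_tsupport {f : E2 → ℝ} {x : E2} (hx : x ∉ tsupport f) (v : E2) :
    lineDeriv ℝ f x v = 0 := by
  have h := notMem_tsupport_iff_eventuallyEq.1 hx
  rw [h.lineDeriv_eq]
  simp [lineDeriv]

lemma LipschitzWith.integrable_lineDeriv {K : NNReal} {f : E2 → ℝ} (hf : LipschitzWith K f)
    (hs : HasCompactSupport f) (v : E2) : Integrable fun x => lineDeriv ℝ f x v := by
  have hsub : Function.support (fun x => lineDeriv ℝ f x v) ⊆ tsupport f := fun x hx => by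
    by_contra h
    exact hx (lineDeriv_eq_zero_of_notMem_tsupport h v)
  rw [← integrableOn_iff_integrable_of_support_subset hsub]
  exact Measure.integrableOn_of_bounded (M := K * ‖v‖) hs.isCompact.measure_lt_top.ne
    (aestronglyMeasurable_lineDeriv hf.continuous volume)
    (Eventually.of_forall fun x => norm_lineDeriv_le_of_lipschitz ℝ hf)

/-- Symmetry of the mixed second derivatives, in weak form, for Lipschitz functions. -/
lemma integral_lineDeriv_mul_lineDeriv_comm {K L : NNReal} {u η : E2 → ℝ}
    (hu : LipschitzWith K u) (hus : HasCompactSupport u)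
    (hη : LipschitzWith L η) (hηs : HasCompactSupport η) (v w : E2) :
    ∫ x, lineDeriv ℝ u x v * lineDeriv ℝ η x w = ∫ x, lineDeriv ℝ u x w * lineDeriv ℝ η x v := by
  have A := LipschitzWith.integral_inv_smul_sub_mul_tendsto_integral_lineDeriv_mul (μ := volume)
    hu (hη.integrable_lineDeriv hηs w) v
  have B := LipschitzWith.integral_inv_smul_sub_mul_tendsto_integral_lineDeriv_mul (μ := volume)
    hη (hu.integrable_lineDeriv hus (-w)) (-v)
  have C : ∫ x, lineDeriv ℝ u x w * lineDeriv ℝ η x v =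
      ∫ x, lineDeriv ℝ η x (-v) * lineDeriv ℝ u x (-w) := by
    congr 1 with x
    rw [lineDeriv_neg, lineDeriv_neg]
    ring
  rw [C]
  refine tendsto_nhds_unique A (B.congr fun t => ?_)
  have hdl : LipschitzWith (‖t⁻¹‖₊ * (K + K)) fun x => t⁻¹ • (u (x + t • v) - u x) :=
    (lipschitzWith_smul t⁻¹).comp
      (((hu.comp (isometry_add_right (t • v)).lipschitz).sub hu).weaken (by simp))
  have hparts := LipschitzWith.integral_lineDeriv_mul_eq (μ := volume) hdl hη hηs (-w)
  rw [neg_neg] at hparts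
  have hI : ∀ x, lineDeriv ℝ η x w * (t⁻¹ • (u (x + t • v) - u x)) =
      (t⁻¹ • (u (x + t • v) - u x)) * lineDeriv ℝ η x w := fun x => mul_comm _ _
  simp only [hI] at hparts
  rw [← hparts]
  have hd := hu.ae_lineDifferentiableAt (μ := volume) (-w)
  have hd' : ∀ᵐ x : E2, LineDifferentiableAt ℝ u (x + t • v) (-w) :=
    (measurePreserving_add_right volume (t • v)).quasiMeasurePreserving.ae hd
  have hl : ∀ᵐ x : E2, lineDeriv ℝ (fun x => t⁻¹ • (u (x + t • v) - u x)) x (-w) * η x =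
      t⁻¹ * (lineDeriv ℝ u (x + t • v) (-w) * η x - lineDeriv ℝ u x (-w) * η x) := by
    filter_upwards [hd, hd'] with x h1 h2
    have h3 : HasLineDerivAt ℝ (fun x => t⁻¹ • (u (x + t • v) - u x))
        (t⁻¹ • (lineDeriv ℝ u (x + t • v) (-w) - lineDeriv ℝ u x (-w))) x (-w) := by
      have h1' := h1.hasLineDerivAt
      have h2' := h2.hasLineDerivAt
      unfold HasLineDerivAt at h1' h2' ⊢
      have h4 := (h2'.sub h1').const_smul t⁻¹
      refine h4.congr_of_eventuallyEq (Eventually.of_forall fun s => ?_)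
      simp [add_right_comm]
    rw [h3.lineDeriv, smul_eq_mul]
    ring
  have hint := hu.integrable_lineDeriv hus (-w)
  have hηb : ∃ C, ∀ x, ‖η x‖ ≤ C := hη.continuous.bounded_above_of_compact_support hηs
  obtain ⟨M, hM⟩ := hηb
  have i1 : Integrable fun x => lineDeriv ℝ u x (-w) * η x :=
    hint.mul_bdd hη.continuous.aestronglyMeasurable (Eventually.of_forall hM)
  have i2 : Integrable fun x => lineDeriv ℝ u (x + t • v) (-w) * η x :=
    (hint.comp_add_right (t • v)).mul_bdd hη.continuous.aestronglyMeasurable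
      (Eventually.of_forall hM)
  have i3 : Integrable fun x => lineDeriv ℝ u x (-w) * η (x + t • (-v)) :=
    hint.mul_bdd (hη.continuous.comp (continuous_add_const _)).aestronglyMeasurable
      (Eventually.of_forall fun x => hM _)
  rw [integral_congr_ae hl, integral_const_mul, integral_sub i2 i1]
  have hshift : ∫ x, lineDeriv ℝ u (x + t • v) (-w) * η x =
      ∫ x, lineDeriv ℝ u x (-w) * η (x + t • (-v)) := by
    rw [← integral_add_right_eq_self _ (t • (-v))]
    simp
  rw [hshift, ← integral_sub i3 i1, ← integral_const_mul]
  congr 1 with x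
  rw [smul_eq_mul]
  ring

lemma LipOn.exists_extension {w : E2 → ℝ} {s : Set E2} (hw : LipOn w s)
    (hs : Bornology.IsBounded s) :
    ∃ (K : NNReal) (w' : E2 → ℝ), LipschitzWith K w' ∧ HasCompactSupport w' ∧ EqOn w w' s := by
  obtain ⟨K, hK⟩ := hw
  obtain ⟨g, hg, hgw⟩ := hK.extend_real
  obtain ⟨R, hR⟩ := hs.subset_closedBall (0 : E2)
  obtain ⟨C, hC⟩ := (isCompact_closedBall (0 : E2) R).exists_bound_of_continuousOn
    hg.continuous.continuousOn
  set B : E2 → ℝ := fun x => max 0 (R + C - ‖x‖) with hB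
  have hBl : LipschitzWith 1 B := by
    have : LipschitzWith 1 fun x : E2 => R + C - ‖x‖ :=
      ((LipschitzWith.const (R + C)).sub lipschitzWith_one_norm).weaken (by simp)
    exact (LipschitzWith.const_max this 0)
  refine ⟨_, fun x => max (min (g x) (B x)) (-B x), (hg.min hBl).max hBl.neg, ?_, ?_⟩
  · refine HasCompactSupport.intro (isCompact_closedBall (0 : E2) (R + C)) fun x hx => ?_
    have h1 : B x = 0 := by
      rw [mem_closedBall_zero_iff, not_le] at hx
      exact max_eq_left (by linarith)
    simp [h1]
  · intro x hx
    have hxR := hR hx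
    have h1 := abs_le.1 (hC x hxR)
    rw [mem_closedBall_zero_iff] at hxR
    have h2 : C ≤ B x := le_max_of_le_right (by linarith)
    rw [hgw hx]
    show g x = max (min (g x) (B x)) (-B x)
    rw [min_eq_left (by linarith), max_eq_left (by linarith)]

lemma IsStreamFn.norm_gradient {k : ℝ → ℝ} (hk : ∀ r, 0 ≤ r → 0 ≤ k r) (hk0 : k 0 = 0)
    {Ω : Set E2} (hΩ : IsOpen Ω) {u v : E2 → ℝ} (hv : IsStreamFn k Ω u v) :
    ∀ᵐ x, x ∈ Ω → ‖gradient v x‖ = k ‖gradient u x‖ := by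
  filter_upwards [(ae_restrict_iff' hΩ.measurableSet).1 hv.2.2] with x hx hxΩ
  obtain ⟨h0, h1⟩ := hx hxΩ
  have hn : ∀ p : E2, ‖p‖ ^ 2 = p 0 ^ 2 + p 1 ^ 2 := fun p => by
    rw [EuclideanSpace.real_norm_sq_eq, Fin.sum_univ_two]
  rw [← sq_eq_sq₀ (norm_nonneg _) (hk _ (norm_nonneg _)), hn, h0, h1]
  split_ifs with hp
  · simp [hp, hk0]
  · have : ‖gradient u x‖ ≠ 0 := norm_ne_zero_iff.2 hp
    field_simp
    rw [hn (gradient u x)]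
    ring

/-- The stream function of `u` solves the equation with the inverse nonlinearity. -/
lemma IsStreamFn.weakSol {k g : ℝ → ℝ} (hk : ∀ r, 0 ≤ r → 0 ≤ k r) (hg : ∀ r, 0 ≤ r → g (k r) = r)
    (hk0 : k 0 = 0)
    {Ω : Set E2} (hΩ : IsOpen Ω) (hb : Bornology.IsBounded Ω) {u v : E2 → ℝ}
    (hu : LipOn u Ω) (hv : IsStreamFn k Ω u v) : WeakSol (radial g) Ω v := by
  intro η hη
  obtain ⟨L, hL⟩ := hη.lip
  obtain ⟨K, u', hu', hus, huu⟩ := hu.exists_extension hb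
  have key := integral_lineDeriv_mul_lineDeriv_comm hu' hus hL (hη.hasCompactSupport hb)
    (EuclideanSpace.single 0 1) (EuclideanSpace.single 1 1)
  have i1 : Integrable fun x => lineDeriv ℝ u' x (EuclideanSpace.single 0 1) *
      lineDeriv ℝ η x (EuclideanSpace.single 1 1) :=
    (hu'.integrable_lineDeriv hus _).mul_bdd
      (aestronglyMeasurable_lineDeriv hL.continuous volume)
      (Eventually.of_forall fun x => norm_lineDeriv_le_of_lipschitz ℝ hL)
  have i2 : Integrable fun x => lineDeriv ℝ u' x (EuclideanSpace.single 1 1) *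
      lineDeriv ℝ η x (EuclideanSpace.single 0 1) :=
    (hu'.integrable_lineDeriv hus _).mul_bdd
      (aestronglyMeasurable_lineDeriv hL.continuous volume)
      (Eventually.of_forall fun x => norm_lineDeriv_le_of_lipschitz ℝ hL)
  rw [← sub_eq_zero, ← integral_sub i1 i2] at key
  rw [← key]
  refine integral_congr_ae ?_
  filter_upwards [(ae_restrict_iff' hΩ.measurableSet).1 hv.2.2, hv.norm_gradient hk hk0 hΩ,
    hu'.ae_differentiableAt (μ := volume),
    hL.ae_differentiableAt (μ := volume)] with x hx hxn hux hηx
  rw [← gradient_apply_eq_lineDeriv hux, ← gradient_apply_eq_lineDeriv hux,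
    ← gradient_apply_eq_lineDeriv hηx, ← gradient_apply_eq_lineDeriv hηx]
  by_cases hxΩ : x ∈ Ω
  · rw [← gradient_congr_of_isOpen hΩ huu hxΩ]
    obtain ⟨h0, h1⟩ := hx hxΩ
    set p := gradient u x
    set q := gradient v x
    have hnq : ‖q‖ = k ‖p‖ := hxn hxΩ
    rw [inner_eq_coords, radial, hnq, hg _ (norm_nonneg _)]
    simp only [PiLp.smul_apply, smul_eq_mul]
    rw [h0, h1]
    split_ifs with hp
    · simp [hp]
    · by_cases hkp : k ‖p‖ = 0
      · exfalso
        have h3 := hg _ (norm_nonneg p)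
        have h4 := hg 0 le_rfl
        rw [hkp] at h3
        rw [hk0] at h4
        exact hp (norm_eq_zero.1 (h3.symm.trans h4))
      · have : ‖p‖ ≠ 0 := norm_ne_zero_iff.2 hp
        field_simp
        ring
  · simp [hη.gradient_eq_zero hxΩ]

/-- A bounded open set with a nontrivial supporting half-plane at each boundary point is convex. -/
lemma convex_of_forall_frontier_exists_le {Ω : Set E2} (hΩ : IsOpen Ω)
    (hb : Bornology.IsBounded Ω)
    (h : ∀ z ∈ frontier Ω, ∃ a : E2, a ≠ 0 ∧ ∀ x ∈ frontier Ω, ⟪a, z⟫ ≤ ⟪a, x⟫) :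
    Convex ℝ Ω := by
  have hpos : ∀ z ∈ frontier Ω, ∀ a : E2, a ≠ 0 → (∀ x ∈ frontier Ω, ⟪a, z⟫ ≤ ⟪a, x⟫) →
      ∀ x ∈ Ω, ⟪a, z⟫ < ⟪a, x⟫ := by
    intro z hz a ha hza x hx
    by_contra! hlt
    obtain ⟨R, hR⟩ := hb.subset_closedBall x
    have ha' : 0 < ‖a‖ := norm_pos_iff.2 ha
    set t : ℝ := (|R| + 1) / ‖a‖ with ht
    have htpos : 0 < t := by positivity
    have hout : x - t • a ∉ Ω := fun hmem => by
      have := hR hmem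
      rw [mem_closedBall, dist_eq_norm, sub_sub_cancel_left, norm_neg, norm_smul, Real.norm_eq_abs,
        abs_of_pos htpos, ht, div_mul_cancel₀ _ ha'.ne'] at this
      linarith [le_abs_self R]
    obtain ⟨y, hy, hyf⟩ := exists_mem_segment_frontier hΩ hx hout
    rw [segment_eq_image'] at hy
    obtain ⟨s, hs, rfl⟩ := hy
    have hs0 : s ≠ 0 := by
      rintro rfl
      rw [hΩ.frontier_eq] at hyf
      simp [hx] at hyf
    have hs1 : 0 < s := lt_of_le_of_ne hs.1 hs0.symm
    have h1 := hza _ hyf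
    have h2 : ⟪a, x + s • (x - t • a - x)⟫ = ⟪a, x⟫ - s * (t * ‖a‖ ^ 2) := by
      rw [sub_sub_cancel_left, inner_add_right, inner_smul_right, inner_neg_right,
        inner_smul_right, real_inner_self_eq_norm_sq]
      ring
    have h3 : 0 < s * (t * ‖a‖ ^ 2) := by positivity
    simp only at h1
    linarith
  rw [convex_iff_segment_subset]
  intro x hx y hy w hw
  by_contra hwΩ
  obtain ⟨z, hz, hzf⟩ := exists_mem_segment_frontier hΩ hx hwΩ
  have hzs : z ∈ segment ℝ x y :=
    (convex_segment x y).segment_subset (left_mem_segment ℝ x y) hw hz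
  obtain ⟨a, ha, haz⟩ := h z hzf
  have h1 := hpos z hzf a ha haz x hx
  have h2 := hpos z hzf a ha haz y hy
  have h3 : z ∈ {v : E2 | ⟪a, z⟫ < ⟪a, v⟫} :=
    (convex_halfSpace_gt (innerₛₗ ℝ a).isLinear ⟪a, z⟫).segment_subset h1 h2 hzs
  exact lt_irrefl ⟪a, z⟫ h3

lemma lipschitzOnWith_of_convex {Ω : Set E2} (hΩ : IsOpen Ω) (hc : Convex ℝ Ω) {v : E2 → ℝ}
    (hv : LipOn v Ω) {M : NNReal} (hM : ∀ᵐ z, z ∈ Ω → ‖gradient v z‖ ≤ M) :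
    LipschitzOnWith M v Ω := by
  obtain ⟨K, hK⟩ := hv
  obtain ⟨V, hV, hvV⟩ := hK.extend_real
  refine LipschitzOnWith.of_dist_le_mul fun x hx y hy => ?_
  rw [hvV hx, hvV hy, dist_eq_norm, dist_eq_norm]
  refine abs_sub_le_of_ae_norm_gradient_le hV hΩ hc ?_ hy hx
  filter_upwards [hM] with z hz hzΩ
  rw [← gradient_congr_of_isOpen hΩ hvV hzΩ]
  exact hz hzΩ

lemma lipschitzOnWith_of_gradient_eq_const {Ω : Set E2} (hΩ : IsOpen Ω) (hp : IsPreconnected Ω)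
    {v : E2 → ℝ} (hv : LipOn v Ω) {q : E2} (hq : ∀ᵐ z, z ∈ Ω → gradient v z = q) {M : NNReal}
    (hM : ‖q‖ ≤ M) : LipschitzOnWith M v Ω := by
  obtain ⟨K, hK⟩ := hv
  obtain ⟨V, hV, hvV⟩ := hK.extend_real
  set W : E2 → ℝ := fun x => V x - ⟪q, x⟫ with hW
  have hWl : LipschitzWith (K + ‖q‖₊) W := hV.sub <| by
    refine LipschitzWith.of_dist_le_mul fun x y => ?_
    rw [Real.dist_eq, ← inner_sub_right, dist_eq_norm, coe_nnnorm]
    exact abs_real_inner_le_norm _ _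
  have hg0 : ∀ᵐ z, z ∈ Ω → ‖gradient W z‖ ≤ 0 := by
    filter_upwards [hq, hV.ae_differentiableAt (μ := volume)] with z hz hd hzΩ
    have h1 : HasGradientAt V q z := by
      rw [← hz hzΩ, gradient_congr_of_isOpen hΩ hvV hzΩ]
      exact hd.hasGradientAt
    have h2 : HasGradientAt W 0 z := by
      rw [hasGradientAt_iff_hasFDerivAt] at h1 ⊢
      have := h1.sub ((innerSL ℝ q).hasFDerivAt (x := z))
      convert! this using 1
      ext x
      simp
    rw [h2.gradient, norm_zero]
  have hball : ∀ x ∈ Ω, W =ᶠ[𝓝 x] fun _ => W x := by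
    intro x hx
    obtain ⟨r, hr, hrΩ⟩ := Metric.isOpen_iff.1 hΩ x hx
    filter_upwards [ball_mem_nhds x hr] with y hy
    have := abs_sub_le_of_ae_norm_gradient_le (M := 0) hWl isOpen_ball (convex_ball x r)
      (by filter_upwards [hg0] with z hz hzb using hz (hrΩ hzb)) (mem_ball_self hr) hy
    rw [zero_mul, abs_nonpos_iff, sub_eq_zero] at this
    exact this
  have hconst : ∀ x ∈ Ω, ∀ y ∈ Ω, W x = W y := fun x hx y hy =>
    hΩ.is_const_of_fderiv_eq_zero (𝕜 := ℝ) hp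
      (fun z hz => ((hball z hz).differentiableAt_iff.2
        (differentiableAt_const _)).differentiableWithinAt)
      (fun z hz => by rw [(hball z hz).fderiv_eq]; simp) hx hy
  refine LipschitzOnWith.of_dist_le_mul fun x hx y hy => ?_
  have h1 := hconst x hx y hy
  have h2 : v x - v y = ⟪q, x - y⟫ := by
    rw [hvV hx, hvV hy, inner_sub_right]
    simp only [hW] at h1
    linarith
  rw [Real.dist_eq, h2, dist_eq_norm]
  exact (abs_real_inner_le_norm _ _).trans (by gcongr)

/-- Lipschitz bound for the stream functions under the bounded slope condition. -/
lemma IsStreamFn.lipschitzOnWith {f : ℝ → ℝ} (hf : IsLagrangian f) {Ω : Set E2} (hΩ : IsOpen Ω)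
    (hb : Bornology.IsBounded Ω) (hp : IsPreconnected Ω) {ψ u v : E2 → ℝ} {Q : NNReal}
    (hbsc : BSC Ω ψ Q) (hu : SolvesP f Ω ψ u) (hv : IsStreamFn (dtop f) Ω u v) {M : NNReal}
    (hM : dtop f Q ≤ M) : LipschitzOnWith M v Ω := by
  have hG := hf.continuous_radial_dtop
  have hws := hf.weakSol hΩ hb hu
  have huQ := lipschitzOnWith_of_BSC hG hf.inner_radial_sub_pos hΩ hb hu.1 hws hu.2.1 hbsc
  have hbound : ∀ᵐ z, z ∈ Ω → ‖gradient v z‖ ≤ M := by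
    filter_upwards [hv.norm_gradient (fun r => hf.dtop_nonneg) hf.dtop_zero hΩ] with z hz hzΩ
    rw [hz hzΩ]
    exact (hf.strictMono.monotoneOn (norm_nonneg _) Q.2
      (norm_gradient_le huQ (hΩ.mem_nhds hzΩ))).trans hM
  by_cases hcase : ∀ z ∈ frontier Ω, ∃ a : E2, a ≠ 0 ∧ ∀ x ∈ frontier Ω, ⟪a, z⟫ ≤ ⟪a, x⟫
  · exact lipschitzOnWith_of_convex hΩ (convex_of_forall_frontier_exists_le hΩ hb hcase) hv.1 hbound
  · push Not at hcase
    obtain ⟨z, hz, hza⟩ := hcase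
    obtain ⟨a, b, c, d, -, -, hab, ha, hb'⟩ := hbsc z hz
    have hba : b - a = 0 := by
      by_contra hne
      obtain ⟨x, hx, hlt⟩ := hza _ hne
      have := hab x hx
      simp only [inner_sub_left] at hlt
      linarith
    rw [sub_eq_zero] at hba
    subst hba
    have hcd : c = d := by linarith
    subst hcd
    have haff := affine_le_weakSol_le hG hf.inner_radial_sub_pos hΩ hb hu.1 hws hu.2.1 hab
    have hgu : ∀ x ∈ Ω, gradient u x = b := fun x hx => by
      rw [gradient_congr_of_isOpen hΩ (g := fun y => ⟪b, y⟫ + c)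
        (fun y hy => le_antisymm (haff y (subset_closure hy)).2 (haff y (subset_closure hy)).1) hx,
        gradient_affine]
    rcases Ω.eq_empty_or_nonempty with rfl | hne
    · simp
    set q : E2 := !₂[if b = 0 then 0 else -(dtop f ‖b‖ * b 1 / ‖b‖),
      if b = 0 then 0 else dtop f ‖b‖ * b 0 / ‖b‖] with hq
    have hgv : ∀ᵐ x, x ∈ Ω → gradient v x = q := by
      filter_upwards [(ae_restrict_iff' hΩ.measurableSet).1 hv.2.2] with x hx hxΩ
      obtain ⟨h0, h1⟩ := hx hxΩ
      rw [hgu x hxΩ] at h0 h1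
      ext i
      fin_cases i
      · simpa [hq] using h0
      · simpa [hq] using h1
    refine lipschitzOnWith_of_gradient_eq_const hΩ hp hv.1 hgv ?_
    have hex : ∃ x ∈ Ω, gradient v x = q ∧ ‖gradient v x‖ ≤ M := by
      by_contra! hno
      have : ∀ᵐ x, x ∉ Ω := by
        filter_upwards [hgv, hbound] with x h1 h2 h3
        exact absurd (h2 h3) (not_le.2 (hno x h3 (h1 h3)))
      rw [ae_iff] at this
      simp only [not_not, Set.ofPred_mem_eq] at this
      exact (hΩ.measure_pos volume hne).ne' this
    obtain ⟨x, -, hx, h⟩ := hex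
    rwa [hx] at h

lemma exists_subseq_tendstoUniformlyOn_of_lipschitzOnWith {Ω : Set E2}
    (hb : Bornology.IsBounded Ω) {M : NNReal} {w : ℕ → E2 → ℝ}
    (hL : ∀ n, LipschitzOnWith M (w n) Ω) {C : ℝ} (hC : ∀ n, ∀ x ∈ Ω, |w n x| ≤ C) :
    ∃ σ : ℕ → ℕ, StrictMono σ ∧ ∃ v : E2 → ℝ,
      TendstoUniformlyOn (fun k => w (σ k)) v atTop Ω := by
  choose g hg hwg using fun n => (hL n).extend_real
  have : CompactSpace (closure Ω) := isCompact_iff_compactSpace.1 hb.isCompact_closure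
  let G : ℕ → BoundedContinuousFunction (closure Ω) ℝ := fun n =>
    BoundedContinuousFunction.mkOfCompact ⟨fun x => g n x, (hg n).continuous.comp continuous_subtype_val⟩
  have hbd : ∀ n, ∀ x ∈ closure Ω, g n x ∈ Icc (-C) C := by
    intro n x hx
    have hcl : IsClosed (g n ⁻¹' Icc (-C) C) := isClosed_Icc.preimage (hg n).continuous
    exact closure_minimal (fun y hy => by
      rw [mem_preimage, ← hwg n hy]
      exact abs_le.1 (hC n y hy)) hcl hx
  have hcomp : IsCompact (closure (range G)) := by
    refine BoundedContinuousFunction.arzela_ascoli (Icc (-C) C) isCompact_Icc (range G) ?_ ?_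
    · rintro _ x ⟨n, rfl⟩
      exact hbd n x x.2
    · refine (LipschitzWith.uniformEquicontinuous _ M ?_).equicontinuous
      rintro ⟨_, n, rfl⟩
      exact (hg n).comp (LipschitzWith.subtype_val _) |>.weaken (by simp)
  obtain ⟨v, -, σ, hσ, hv⟩ := hcomp.tendsto_subseq (x := G) fun n => subset_closure ⟨n, rfl⟩
  refine ⟨σ, hσ, fun x => if hx : x ∈ closure Ω then v ⟨x, hx⟩ else 0, ?_⟩
  rw [BoundedContinuousFunction.tendsto_iff_tendstoUniformly] at hv
  rw [Metric.tendstoUniformlyOn_iff]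
  intro ε hε
  filter_upwards [Metric.tendstoUniformly_iff.1 hv ε hε] with k hk x hx
  have hx' := subset_closure hx
  rw [dif_pos hx', hwg _ hx]
  exact hk ⟨x, hx'⟩

lemma abs_le_of_setIntegral_eq_zero {Ω : Set E2} (hΩ : IsOpen Ω) (hb : Bornology.IsBounded Ω)
    {M : NNReal} {w : E2 → ℝ} (hL : LipschitzOnWith M w Ω) (h0 : ∫ z in Ω, w z = 0) :
    ∀ x ∈ Ω, |w x| ≤ M * diam Ω := by
  have key : ∀ w : E2 → ℝ, LipschitzOnWith M w Ω → ∫ z in Ω, w z = 0 →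
      ∀ x ∈ Ω, w x ≤ M * diam Ω := by
    intro w hL h0 x hx
    by_contra! hlt
    have hd : ∀ y ∈ Ω, |w x - w y| ≤ M * diam Ω := fun y hy =>
      (hL.dist_le_mul x hx y hy).trans <| by
        gcongr
        exact dist_le_diam_of_mem hb hx hy
    have hpos : ∀ y ∈ Ω, 0 < w y := fun y hy => by
      linarith [hd y hy, le_abs_self (w x - w y)]
    obtain ⟨_, w', hw', hws, hww⟩ := LipOn.exists_extension ⟨M, hL⟩ hb
    have hint : IntegrableOn w Ω :=
      (hw'.continuous.integrable_of_hasCompactSupport hws).integrableOn.congr_fun hww.symm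
        hΩ.measurableSet
    have := (setIntegral_pos_iff_support_of_nonneg_ae
      ((ae_restrict_iff' hΩ.measurableSet).2 (Eventually.of_forall fun y hy => (hpos y hy).le))
      hint).2 ((hΩ.measure_pos volume ⟨x, hx⟩).trans_le
        (measure_mono fun y hy => ⟨(hpos y hy).ne', hy⟩))
    exact this.ne' h0
  intro x hx
  refine abs_le'.2 ⟨key w hL h0 x hx, key (fun y => -w y) hL.neg ?_ x hx⟩
  rw [integral_neg, h0, neg_zero]

lemma hasFDerivAt_norm_of_ne_zero {p : E2} (hp : p ≠ 0) :
    HasFDerivAt (fun q : E2 => ‖q‖) (‖p‖⁻¹ • innerSL ℝ p) p := by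
  have h := (hasStrictFDerivAt_norm_sq p).hasFDerivAt.sqrt (by simpa using hp)
  simp only [Real.sqrt_sq (norm_nonneg _)] at h
  convert! h using 1
  ext v
  simp
  ring

lemma hasFDerivAt_radial {h : ℝ → ℝ} {h' : ℝ} {p : E2} (hp : p ≠ 0) (hh : HasDerivAt h h' ‖p‖) :
    HasFDerivAt (radial h) ((h ‖p‖ / ‖p‖) • ContinuousLinearMap.id ℝ E2 +
      (((h' - h ‖p‖ / ‖p‖) / ‖p‖ ^ 2) • innerSL ℝ p).smulRight p) p := by
  have hn := hasFDerivAt_norm_of_ne_zero hp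
  have hp' : ‖p‖ ≠ 0 := norm_ne_zero_iff.2 hp
  have h1 : HasFDerivAt (fun q : E2 => h ‖q‖ / ‖q‖)
      (((h' * ‖p‖ - h ‖p‖ * 1) / ‖p‖ ^ 2) • (‖p‖⁻¹ • innerSL ℝ p)) p :=
    (hh.div (hasDerivAt_id _) hp').comp_hasFDerivAt p hn
  have h2 := h1.smul (hasFDerivAt_id p)
  convert! h2 using 1
  congr 2
  rw [smul_smul]
  congr 1
  field_simp

lemma trace_add_smulRight_comp (c d : ℝ) (p : E2) (H : E2 →L[ℝ] E2) :
    LinearMap.trace ℝ E2 ((c • ContinuousLinearMap.id ℝ E2 +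
      (d • innerSL ℝ p).smulRight p).comp H).toLinearMap =
    c * LinearMap.trace ℝ E2 H.toLinearMap + d * ⟪H p, p⟫ := by
  have h : ((c • ContinuousLinearMap.id ℝ E2 +
      (d • innerSL ℝ p).smulRight p).comp H).toLinearMap =
      c • H.toLinearMap + ((d • innerₛₗ ℝ p) ∘ₗ H.toLinearMap).smulRight p := by
    ext v
    simp
  rw [h, map_add, map_smul, LinearMap.trace_smulRight]
  simp [real_inner_comm]

/-- A Lipschitz field with nonpositive divergence. -/
lemma integral_inner_gradient_nonneg_of_trace_nonpos {U : Set E2} (hU : IsOpen U)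
    (hb : Bornology.IsBounded U) {X : E2 → E2} (hX : ∃ K, LipschitzOnWith K X U)
    {D : E2 → E2 →L[ℝ] E2} (hD : ∀ x ∈ U, HasFDerivAt X (D x) x)
    (htr : ∀ x ∈ U, LinearMap.trace ℝ E2 (D x).toLinearMap ≤ 0) {η : E2 → ℝ}
    (hη : IsTestFn U η) : 0 ≤ ∫ x, ⟪X x, gradient η x⟫ := by
  obtain ⟨K, hK⟩ := hX
  obtain ⟨L, hL⟩ := hη.lip
  have hηs := hη.hasCompactSupport hb
  have hi : ∀ i : Fin 2, LipOn (fun x => X x i) U := fun i =>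
    ⟨K, LipschitzOnWith.of_dist_le_mul fun x hx y hy => by
      refine le_trans ?_ (hK.dist_le_mul x hx y hy)
      rw [Real.dist_eq, dist_eq_norm, ← PiLp.sub_apply, ← Real.norm_eq_abs]
      exact PiLp.norm_apply_le _ _⟩
  choose KY Y hY hYs hXY using fun i => (hi i).exists_extension hb
  have hparts := fun i : Fin 2 => LipschitzWith.integral_lineDeriv_mul_eq (μ := volume) (hY i) hL hηs
    (-EuclideanSpace.single i 1)
  simp only [neg_neg, lineDeriv_neg] at hparts
  have hint1 : ∀ i : Fin 2, Integrable fun x =>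
      lineDeriv ℝ η x (EuclideanSpace.single i 1) * Y i x := fun i => by
    obtain ⟨C, hC⟩ := (hY i).continuous.bounded_above_of_compact_support (hYs i)
    exact (hL.integrable_lineDeriv hηs _).mul_bdd (hY i).continuous.aestronglyMeasurable
      (Eventually.of_forall hC)
  have hint2 : ∀ i : Fin 2, Integrable fun x =>
      -lineDeriv ℝ (Y i) x (EuclideanSpace.single i 1) * η x := fun i => by
    obtain ⟨C, hC⟩ := hL.continuous.bounded_above_of_compact_support hηs
    exact ((hY i).integrable_lineDeriv (hYs i) _).neg.mul_bdd hL.continuous.aestronglyMeasurable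
      (Eventually.of_forall hC)
  have hEq : ∫ x, ⟪X x, gradient η x⟫ =
      ∫ x, (-lineDeriv ℝ (Y 0) x (EuclideanSpace.single 0 1) * η x +
        -lineDeriv ℝ (Y 1) x (EuclideanSpace.single 1 1) * η x) := by
    rw [integral_add (hint2 0) (hint2 1), hparts, hparts, ← integral_add (hint1 0) (hint1 1)]
    refine integral_congr_ae ?_
    filter_upwards [hL.ae_differentiableAt (μ := volume)] with x hx
    by_cases hxU : x ∈ U
    · rw [inner_eq_coords, gradient_apply_eq_lineDeriv hx, gradient_apply_eq_lineDeriv hx,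
        ← hXY 0 hxU, ← hXY 1 hxU]
      ring
    · rw [← gradient_apply_eq_lineDeriv hx, ← gradient_apply_eq_lineDeriv hx,
        hη.gradient_eq_zero hxU]
      simp
  rw [hEq]
  refine integral_nonneg fun x => ?_
  by_cases hxU : x ∈ U
  · have hd : ∀ i : Fin 2, lineDeriv ℝ (Y i) x (EuclideanSpace.single i 1) =
        D x (EuclideanSpace.single i 1) i := fun i => by
      have h1 : HasFDerivAt (fun y => X y i) ((EuclideanSpace.proj i).comp (D x)) x :=
        (EuclideanSpace.proj (𝕜 := ℝ) i).hasFDerivAt.comp x (hD x hxU)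
      have h2 : Y i =ᶠ[𝓝 x] fun y => X y i := by
        filter_upwards [hU.mem_nhds hxU] with y hy using (hXY i hy).symm
      rw [h2.lineDeriv_eq, (h1.hasLineDerivAt _).lineDeriv]
      rfl
    have ht := htr x hxU
    rw [LinearMap.trace_eq_sum_inner _ (EuclideanSpace.basisFun (Fin 2) ℝ), Fin.sum_univ_two] at ht
    simp only [EuclideanSpace.basisFun_apply, EuclideanSpace.inner_single_left] at ht
    rw [hd, hd]
    have h0 := hη.nonneg x
    simp at ht ⊢
    nlinarith
  · simp [hη.eq_zero x hxU]

namespace IsLagrangian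

variable {f : ℝ → ℝ}

lemma deriv_dtop_nonneg (hf : IsLagrangian f) {ρ : ℝ} (hρ : 0 < ρ) : 0 ≤ deriv (dtop f) ρ := by
  rw [← derivWithin_of_mem_nhds (Ici_mem_nhds hρ)]
  exact hf.strictMono.monotoneOn.derivWithin_nonneg

/-- The inverse of the uniformly elliptic regularization `ρ ↦ f'(ρ) + ε ρ`. -/
lemma exists_regularized_inverse (hf : IsLagrangian f) (hC : ContDiffOn ℝ 1 (dtop f) (Ioi 0))
    {ε : ℝ} (hε : 0 < ε) : ∃ h : ℝ → ℝ, (∀ r, 0 ≤ r → 0 ≤ h r ∧ dtop f (h r) + ε * h r = r) ∧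
      ContinuousOn h (Ici 0) ∧ ContDiffOn ℝ 1 h (Ioi 0) ∧
      ∀ r, 0 < r → HasDerivAt h (deriv (dtop f) (h r) + ε)⁻¹ r := by
  have hex : ∀ r : ℝ, ∃ ρ, 0 ≤ r → 0 ≤ ρ ∧ dtop f ρ + ε * ρ = r := by
    intro r
    by_cases hr : 0 ≤ r
    · have hc : ContinuousOn (fun ρ => dtop f ρ + ε * ρ) (Icc 0 (r / ε)) :=
        (hf.continuousOn_dtop.mono Icc_subset_Ici_self).add (by fun_prop)
      have hre : 0 ≤ r / ε := by positivity
      have h1 := hf.dtop_nonneg hre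
      have hmem : r ∈ Icc (dtop f 0 + ε * 0) (dtop f (r / ε) + ε * (r / ε)) := by
        rw [hf.dtop_zero, mul_div_cancel₀ _ hε.ne']
        constructor <;> linarith
      obtain ⟨ρ, hρ, hρr⟩ := intermediate_value_Icc hre hc hmem
      exact ⟨ρ, fun _ => ⟨hρ.1, hρr⟩⟩
    · exact ⟨0, fun h => absurd h hr⟩
  choose h hh using hex
  have hmono : ∀ r s, 0 ≤ r → r ≤ s → h r ≤ h s ∧ ε * (h s - h r) ≤ s - r := by
    intro r s hr hrs
    obtain ⟨h1, h2⟩ := hh r hr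
    obtain ⟨h3, h4⟩ := hh s (hr.trans hrs)
    have hle : h r ≤ h s := by
      by_contra! hlt
      have := hf.strictMono h3 h1 hlt
      nlinarith
    refine ⟨hle, ?_⟩
    have := hf.strictMono.monotoneOn h1 h3 hle
    linarith
  have hlip : LipschitzOnWith (Real.toNNReal ε⁻¹) h (Ici 0) := by
    refine LipschitzOnWith.of_dist_le_mul fun x hx y hy => ?_
    rw [Real.coe_toNNReal _ (by positivity), Real.dist_eq, Real.dist_eq, inv_mul_eq_div,
      le_div_iff₀ hε]
    rcases le_total x y with hxy | hxy
    · obtain ⟨h1, h2⟩ := hmono x y hx hxy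
      rw [abs_sub_comm, abs_of_nonneg (by linarith), abs_sub_comm, abs_of_nonneg (by linarith)]
      linarith
    · obtain ⟨h1, h2⟩ := hmono y x hy hxy
      rw [abs_of_nonneg (by linarith), abs_of_nonneg (by linarith)]
      linarith
  have hcont := hlip.continuousOn
  have hpos : ∀ r, 0 < r → 0 < h r := by
    intro r hr
    obtain ⟨h1, h2⟩ := hh r hr.le
    refine lt_of_le_of_ne h1 fun h0 => ?_
    rw [← h0, hf.dtop_zero] at h2
    linarith
  have hderiv : ∀ r, 0 < r → HasDerivAt h (deriv (dtop f) (h r) + ε)⁻¹ r := by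
    intro r hr
    have hd : HasDerivAt (dtop f) (deriv (dtop f) (h r)) (h r) :=
      ((hC.differentiableOn one_ne_zero).differentiableAt (Ioi_mem_nhds (hpos r hr))).hasDerivAt
    refine HasDerivAt.of_local_left_inverse (f := fun ρ => dtop f ρ + ε * ρ)
      (hcont.continuousAt (Ici_mem_nhds hr)) ?_ ?_ ?_
    · have := hd.add ((hasDerivAt_id (h r)).const_mul ε)
      rw [mul_one] at this
      exact this
    · linarith [hf.deriv_dtop_nonneg (hpos r hr)]
    · filter_upwards [Ioi_mem_nhds hr] with s hs using (hh s (le_of_lt hs)).2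
  refine ⟨h, hh, hcont, ?_, hderiv⟩
  rw [show (1 : WithTop ℕ∞) = 0 + 1 from rfl, contDiffOn_succ_iff_deriv_of_isOpen isOpen_Ioi]
  refine ⟨fun r hr => (hderiv r hr).differentiableAt.differentiableWithinAt, by simp, ?_⟩
  rw [contDiffOn_zero]
  have hc : ContinuousOn (fun r => (deriv (dtop f) (h r) + ε)⁻¹) (Ioi 0) := by
    refine ContinuousOn.inv₀ (((hC.continuousOn_deriv_of_isOpen isOpen_Ioi le_rfl).comp
      (hcont.mono Ioi_subset_Ici_self) hpos).add continuousOn_const) fun r hr => ?_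
    have := hf.deriv_dtop_nonneg (hpos r hr)
    positivity
  exact hc.congr fun r hr => (hderiv r hr).deriv

/-- Ellipticity ratio of the regularized field against that of the original one. -/
lemma trace_regularized_nonpos (hf : IsLagrangian f) {ε ρ s : ℝ} (hε : 0 < ε) (hρ : 0 < ρ)
    (hs : dtop f ρ + ε * ρ = s) {T₁ T₂ : ℝ}
    (hF : 0 ≤ -(1 - ρ * (deriv (dtop f) ρ + ε) / s) * T₁ -
      s ^ 2 * (ρ * (deriv (dtop f) ρ + ε) / s) * T₂) :
    ρ / s * T₂ + ((deriv (dtop f) ρ + ε)⁻¹ - ρ / s) / s ^ 2 * T₁ ≤ 0 := by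
  have h1 := hf.deriv_dtop_nonneg hρ
  have h2 := hf.dtop_nonneg hρ.le
  set k' := deriv (dtop f) ρ
  have hs0 : 0 < s := by rw [← hs]; positivity
  have hk : 0 < k' + ε := by positivity
  have : ρ / s * T₂ + ((k' + ε)⁻¹ - ρ / s) / s ^ 2 * T₁ =
      -((k' + ε)⁻¹ / s ^ 2) * (-(1 - ρ * (k' + ε) / s) * T₁ -
        s ^ 2 * (ρ * (k' + ε) / s) * T₂) := by
    field_simp
    ring
  rw [this]
  have : 0 ≤ (k' + ε)⁻¹ / s ^ 2 := by positivity
  nlinarith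

lemma abs_regularized_ratio_sub_le (hf : IsLagrangian f) {ε ρ s b δ : ℝ} (hε : 0 < ε) (hρ : 0 < ρ)
    (hs : dtop f ρ + ε * ρ = s) (hb : |ρ * deriv (dtop f) ρ / dtop f ρ - b| ≤ δ)
    (hsmall : ε * ρ * (|b| + δ + 1) ≤ s * δ) :
    |ρ * (deriv (dtop f) ρ + ε) / s - b| ≤ 2 * δ := by
  have h2 : 0 < dtop f ρ := by
    rw [← hf.dtop_zero]
    exact hf.strictMono self_mem_Ici hρ.le hρ
  set k' := deriv (dtop f) ρ
  set k := dtop f ρ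
  have hs0 : 0 < s := by rw [← hs]; positivity
  set a := ρ * k' / k with ha
  have h3 : ρ * (k' + ε) / s - b = (a - b) + (1 - a) * (ε * ρ / s) := by
    have : ρ * k' = a * k := by rw [ha]; field_simp
    rw [mul_add, this, ← hs]
    have : k + ε * ρ ≠ 0 := by positivity
    field_simp
    ring
  have h4 : |1 - a| ≤ |b| + δ + 1 := by
    rw [abs_le] at hb ⊢
    constructor <;> linarith [le_abs_self b, neg_abs_le b]
  have h5 : |1 - a| * (ε * ρ / s) ≤ δ := by
    rw [← mul_div_assoc, div_le_iff₀ hs0, mul_comm δ]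
    refine le_trans ?_ hsmall
    rw [mul_comm]
    gcongr
  rw [h3]
  refine (abs_add_le _ _).trans ?_
  rw [abs_mul, abs_of_nonneg (a := ε * ρ / s) (by positivity)]
  linarith

end IsLagrangian

namespace IsLagrangian

variable {f g : ℝ → ℝ}

lemma strictMonoOn_inverse (hf : IsLagrangian f)
    (hg : ∀ r, 0 ≤ r → 0 ≤ g r ∧ dtop f (g r) = r) : StrictMonoOn g (Ici 0) := by
  intro r hr s hs hrs
  obtain ⟨h1, h2⟩ := hg r hr
  obtain ⟨h3, h4⟩ := hg s hs
  by_contra! hle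
  have := hf.strictMono.monotoneOn h3 h1 hle
  linarith

lemma continuousOn_inverse (hf : IsLagrangian f)
    (hg : ∀ r, 0 ≤ r → 0 ≤ g r ∧ dtop f (g r) = r) (hg' : ∀ ρ, 0 ≤ ρ → g (dtop f ρ) = ρ) :
    ContinuousOn g (Ici 0) := by
  have himg : g '' Ici 0 = Ici 0 := by
    ext ρ
    constructor
    · rintro ⟨r, hr, rfl⟩
      exact (hg r hr).1
    · exact fun hρ => ⟨dtop f ρ, hf.dtop_nonneg hρ, hg' ρ hρ⟩
  have hg0 : g 0 = 0 := by
    have := hg' 0 le_rfl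
    rwa [hf.dtop_zero] at this
  intro r hr
  rcases eq_or_lt_of_le (show 0 ≤ r from hr) with rfl | hr'
  · refine (hf.strictMonoOn_inverse hg).continuousWithinAt_right_of_surjOn self_mem_nhdsWithin ?_
    intro ρ hρ
    rw [hg0] at hρ
    exact ⟨dtop f ρ, hf.dtop_nonneg (le_of_lt hρ), hg' ρ (le_of_lt hρ)⟩
  · refine ((hf.strictMonoOn_inverse hg).continuousAt_of_image_mem_nhds (Ici_mem_nhds hr')
      ?_).continuousWithinAt
    rw [himg]
    refine Ici_mem_nhds ?_
    have := hf.strictMonoOn_inverse hg self_mem_Ici hr hr'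
    rwa [hg0] at this

lemma integral_inner_radial_nonneg_of_regularized (hf : IsLagrangian f)
    {p : E2 → E2} (hp : ContDiff ℝ 1 p) {x₀ : E2} {R : ℝ}
    (hp0 : ∀ x ∈ closedBall x₀ R, p x ≠ 0) {ε : ℝ} {h : ℝ → ℝ}
    (hh : ∀ r, 0 ≤ r → 0 ≤ h r ∧ dtop f (h r) + ε * h r = r)
    (hhC : ContDiffOn ℝ 1 h (Ioi 0))
    (hhd : ∀ r, 0 < r → HasDerivAt h (deriv (dtop f) (h r) + ε)⁻¹ r) (hε : 0 < ε)
    (hF : ∀ x ∈ ball x₀ R,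
      0 ≤ -(1 - h ‖p x‖ * (deriv (dtop f) (h ‖p x‖) + ε) / ‖p x‖) * ⟪fderiv ℝ p x (p x), p x⟫ -
        ‖p x‖ ^ 2 * (h ‖p x‖ * (deriv (dtop f) (h ‖p x‖) + ε) / ‖p x‖) *
          LinearMap.trace ℝ E2 (fderiv ℝ p x).toLinearMap)
    {η : E2 → ℝ} (hη : IsTestFn (ball x₀ R) η) :
    0 ≤ ∫ x, ⟪radial h (p x), gradient η x⟫ := by
  refine integral_inner_gradient_nonneg_of_trace_nonpos isOpen_ball isBounded_ball
    (X := fun x => radial h (p x)) ?_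
    (fun x hx => (hasFDerivAt_radial (hp0 x (ball_subset_closedBall hx))
      (hhd _ (norm_pos_iff.2 (hp0 x (ball_subset_closedBall hx))))).comp x
        (hp.differentiable one_ne_zero x).hasFDerivAt) ?_ hη
  · have hcd : ContDiffOn ℝ 1 (fun x => radial h (p x)) (closedBall x₀ R) := by
      intro x hx
      refine ContDiffAt.contDiffWithinAt ?_
      have hn := hp.contDiffAt.norm ℝ (hp0 x hx)
      have hpos := norm_pos_iff.2 (hp0 x hx)
      exact (((hhC.contDiffAt (Ioi_mem_nhds hpos)).comp x hn).div hn hpos.ne').smul hp.contDiffAt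
    obtain ⟨K, hK⟩ := hcd.exists_lipschitzOnWith one_ne_zero (convex_closedBall _ _)
      (isCompact_closedBall _ _)
    exact ⟨K, hK.mono ball_subset_closedBall⟩
  · intro x hx
    have hpos := norm_pos_iff.2 (hp0 x (ball_subset_closedBall hx))
    rw [trace_add_smulRight_comp]
    obtain ⟨h1, h2⟩ := hh _ hpos.le
    have h3 : 0 < h ‖p x‖ := by
      refine lt_of_le_of_ne h1 fun h0 => ?_
      rw [← h0, hf.dtop_zero] at h2
      linarith
    exact hf.trace_regularized_nonpos hε h3 h2 (hF x hx)

/-- Strict classical subsolutions of the limit equation are weak supersolutions for the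
inverse field, provided the ellipticity ratio is close to the limiting one. -/
lemma integral_inner_radial_inverse_nonneg (hf : IsLagrangian f)
    (hC : ContDiffOn ℝ 1 (dtop f) (Ioi 0))
    (hg : ∀ r, 0 ≤ r → 0 ≤ g r ∧ dtop f (g r) = r) (hg' : ∀ ρ, 0 ≤ ρ → g (dtop f ρ) = ρ)
    {p : E2 → E2} (hp : ContDiff ℝ 1 p) {x₀ : E2} {R s₀ τ b δ : ℝ} (hτ : 0 < τ) (hδ : 0 < δ)
    (hτs : 2 * τ ≤ s₀) (hs : ∀ x ∈ closedBall x₀ R, |‖p x‖ - s₀| ≤ τ)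
    (hB : ∀ ρ, 0 < ρ → |dtop f ρ - s₀| ≤ 2 * τ → |ρ * deriv (dtop f) ρ / dtop f ρ - b| ≤ δ)
    (hF : ∀ x ∈ closedBall x₀ R, ∀ c, |c - b| ≤ 2 * δ →
      0 ≤ -(1 - c) * ⟪fderiv ℝ p x (p x), p x⟫ -
        ‖p x‖ ^ 2 * c * LinearMap.trace ℝ E2 (fderiv ℝ p x).toLinearMap)
    {η : E2 → ℝ} (hη : IsTestFn (ball x₀ R) η) :
    0 ≤ ∫ x, ⟪radial g (p x), gradient η x⟫ := by
  have hgm := hf.strictMonoOn_inverse hg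
  have hgc := hf.continuousOn_inverse hg hg'
  obtain ⟨L, hL⟩ := hη.lip
  choose! h hh hhc hhC hhd using fun ε (hε : 0 < ε) => hf.exists_regularized_inverse hC hε
  set G := g (s₀ + τ) with hG
  have hGnn : 0 ≤ G := (hg _ (by linarith)).1
  have hle : ∀ ε, 0 < ε → ∀ r, 0 ≤ r → h ε r ≤ g r := by
    intro ε hε r hr
    obtain ⟨h1, h2⟩ := hh ε hε r hr
    rw [← hg' _ h1]
    refine hgm.monotoneOn (hf.dtop_nonneg h1) hr ?_
    have : 0 ≤ ε * h ε r := by positivity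
    linarith
  have hleG : ∀ ε, 0 < ε → ∀ x ∈ closedBall x₀ R, h ε ‖p x‖ ≤ G := by
    intro ε hε x hx
    refine (hle ε hε _ (norm_nonneg _)).trans (hgm.monotoneOn (norm_nonneg _) ?_ ?_)
    · exact (by linarith : (0:ℝ) ≤ s₀ + τ)
    · linarith [(abs_le.1 (hs x hx)).2]
  have hev : ∀ᶠ ε in 𝓝[>] (0:ℝ), 0 < ε ∧ ε * G < τ ∧
      ε * G * (|b| + δ + 1) < (s₀ - τ) * δ := by
    have t1 : Tendsto (fun ε : ℝ => ε * G) (𝓝 0) (𝓝 (0 * G)) := tendsto_id.mul_const G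
    have t2 := t1.mul_const (|b| + δ + 1)
    have h1 : (0:ℝ) * G < τ := by simpa using hτ
    have h2 : 0 * G * (|b| + δ + 1) < (s₀ - τ) * δ := by
      have : 0 < (s₀ - τ) * δ := mul_pos (by linarith) hδ
      simpa using this
    filter_upwards [self_mem_nhdsWithin, nhdsWithin_le_nhds (t1.eventually_lt_const h1),
      nhdsWithin_le_nhds (t2.eventually_lt_const h2)] with ε e1 e2 e3 using ⟨e1, e2, e3⟩
  have hnonneg : ∀ᶠ ε in 𝓝[>] (0:ℝ), 0 ≤ ∫ x, ⟪radial (h ε) (p x), gradient η x⟫ := by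
    filter_upwards [hev] with ε ⟨hε, e1, e2⟩
    refine hf.integral_inner_radial_nonneg_of_regularized hp ?_ (hh ε hε) (hhC ε hε)
      (hhd ε hε) hε ?_ hη
    · intro x hx h0
      have := (abs_le.1 (hs x hx)).1
      rw [h0, norm_zero] at this
      linarith
    · intro x hx
      have hx' := ball_subset_closedBall hx
      refine hF x hx' _ ?_
      have hsx := abs_le.1 (hs x hx')
      have hpos : 0 < ‖p x‖ := by linarith [hsx.1]
      obtain ⟨h1, h2⟩ := hh ε hε _ hpos.le
      have h3 : 0 < h ε ‖p x‖ := by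
        refine lt_of_le_of_ne h1 fun h0 => ?_
        rw [← h0, hf.dtop_zero] at h2
        linarith
      have h4 : ε * h ε ‖p x‖ ≤ ε * G := mul_le_mul_of_nonneg_left (hleG ε hε x hx') hε.le
      have h5 : 0 ≤ ε * h ε ‖p x‖ := by positivity
      refine hf.abs_regularized_ratio_sub_le hε h3 h2 (hB _ h3 ?_) ?_
      · rw [abs_le]
        constructor <;> linarith [hsx.1, hsx.2]
      · calc ε * h ε ‖p x‖ * (|b| + δ + 1) ≤ ε * G * (|b| + δ + 1) := by gcongr
          _ ≤ (s₀ - τ) * δ := e2.le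
          _ ≤ ‖p x‖ * δ := by
            gcongr
            linarith [hsx.1]
  refine ge_of_tendsto ?_ hnonneg
  have hlim : ∀ r, 0 ≤ r → Tendsto (fun ε => h ε r) (𝓝[>] 0) (𝓝 (g r)) := by
    intro r hr
    have hsq : Tendsto (fun ε => r - ε * h ε r) (𝓝[>] 0) (𝓝[Ici 0] r) := by
      refine tendsto_nhdsWithin_iff.2 ⟨?_, ?_⟩
      · have hz : Tendsto (fun ε => ε * h ε r) (𝓝[>] 0) (𝓝 0) := by
          have hu : Tendsto (fun ε : ℝ => ε * g r) (𝓝[>] 0) (𝓝 0) := by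
            have : Tendsto (fun ε : ℝ => ε * g r) (𝓝 0) (𝓝 (0 * g r)) := tendsto_id.mul_const _
            rw [zero_mul] at this
            exact this.mono_left nhdsWithin_le_nhds
          refine tendsto_of_tendsto_of_tendsto_of_le_of_le' tendsto_const_nhds hu ?_ ?_
          · filter_upwards [self_mem_nhdsWithin] with ε hε
            exact mul_nonneg (le_of_lt hε) (hh ε hε r hr).1
          · filter_upwards [self_mem_nhdsWithin] with ε hε
            exact mul_le_mul_of_nonneg_left (hle ε hε r hr) (le_of_lt hε)
        simpa using hz.const_sub r
      · filter_upwards [self_mem_nhdsWithin] with ε hε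
        obtain ⟨h1, h2⟩ := hh ε hε r hr
        have := hf.dtop_nonneg h1
        rw [mem_Ici]
        linarith
    refine (Tendsto.comp (hgc r hr) hsq).congr' ?_
    filter_upwards [self_mem_nhdsWithin] with ε hε
    obtain ⟨h1, h2⟩ := hh ε hε r hr
    have : r - ε * h ε r = dtop f (h ε r) := by linarith
    rw [Function.comp_apply, this, hg' _ h1]
  have hbound : ∀ ε, 0 < ε → ∀ x ∈ closedBall x₀ R, ‖radial (h ε) (p x)‖ ≤ G := by
    intro ε hε x hx
    have hpos : 0 < ‖p x‖ := by linarith [(abs_le.1 (hs x hx)).1]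
    have hn := (hh ε hε _ hpos.le).1
    rw [radial, norm_smul, Real.norm_eq_abs, abs_of_nonneg (by positivity),
      div_mul_cancel₀ _ hpos.ne']
    exact hleG ε hε x hx
  refine tendsto_integral_filter_of_dominated_convergence
    ((ball x₀ R).indicator fun _ => G * L) ?_ ?_ ?_ ?_
  · filter_upwards [self_mem_nhdsWithin] with ε hε
    have h0 : h ε 0 = 0 := le_antisymm ((hle ε hε 0 le_rfl).trans (by
      have := hg' 0 le_rfl
      rw [hf.dtop_zero] at this
      exact this.le)) (hh ε hε 0 le_rfl).1
    have hc := continuous_radial (hhc ε hε) h0 fun r hr => (hh ε hε r hr).1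
    exact ((hc.comp hp.continuous).measurable.inner (measurable_gradient η)).aestronglyMeasurable
  · filter_upwards [self_mem_nhdsWithin] with ε hε
    refine Eventually.of_forall fun x => ?_
    by_cases hx : x ∈ ball x₀ R
    · rw [indicator_of_mem hx]
      refine (norm_inner_le_norm _ _).trans ?_
      have := hbound ε hε x (ball_subset_closedBall hx)
      gcongr
      exact norm_gradient_le (hL.lipschitzOnWith (s := univ)) univ_mem
    · rw [indicator_of_notMem hx, hη.gradient_eq_zero hx, inner_zero_right, norm_zero]
  · exact (integrable_indicator_iff measurableSet_ball).2 (integrableOn_const measure_ball_lt_top.ne)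
  · refine Eventually.of_forall fun x => ?_
    exact (((hlim _ (norm_nonneg _)).div_const _).smul_const _).inner tendsto_const_nhds

end IsLagrangian

lemma ContDiff.gradient_of_two {φ : E2 → ℝ} (hφ : ContDiff ℝ 2 φ) : ContDiff ℝ 1 (gradient φ) :=
  (InnerProductSpace.toDual ℝ E2).symm.contDiff.comp (hφ.fderiv_right (by norm_num))

lemma gradient_add_sq_add_const {φ : E2 → ℝ} (hφ : Differentiable ℝ φ) (ε c : ℝ) (x₀ x : E2) :
    gradient (fun y => φ y + ε * ‖y - x₀‖ ^ 2 + c) x = gradient φ x + (2 * ε) • (x - x₀) := by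
  refine HasGradientAt.gradient ?_
  rw [hasGradientAt_iff_hasFDerivAt]
  have h1 := (hφ x).hasGradientAt.hasFDerivAt
  have h2 := (((hasFDerivAt_id x).sub_const x₀).norm_sq).const_mul ε
  refine ((h1.add h2).add_const c).congr_fderiv ?_
  ext y
  simp
  ring

lemma continuous_trace_toLinearMap :
    Continuous fun H : E2 →L[ℝ] E2 => LinearMap.trace ℝ E2 H.toLinearMap :=
  LinearMap.continuous_of_finiteDimensional
    ((LinearMap.trace ℝ E2) ∘ₗ (ContinuousLinearMap.coeLM ℝ : (E2 →L[ℝ] E2) →ₗ[ℝ] E2 →ₗ[ℝ] E2))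

/-- The operator `-(1 - c) Δ∞ - ‖∇‖² c Δ` evaluated on a gradient `p` and a Hessian `H`. -/
def ratioOp (c : ℝ) (p : E2) (H : E2 →L[ℝ] E2) : ℝ :=
  -(1 - c) * ⟪H p, p⟫ - ‖p‖ ^ 2 * c * LinearMap.trace ℝ E2 H.toLinearMap

lemma continuous_ratioOp : Continuous fun z : ℝ × E2 × (E2 →L[ℝ] E2) => ratioOp z.1 z.2.1 z.2.2 := by
  have h := continuous_trace_toLinearMap.comp
    (continuous_snd.comp continuous_snd : Continuous fun z : ℝ × E2 × (E2 →L[ℝ] E2) => z.2.2)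
  simp only [Function.comp_def] at h
  unfold ratioOp
  fun_prop

/-- If a strict quadratic perturbation of `φ` is a weak supersolution near `x₀`, then solutions
close to a function touched from above by `φ` at `x₀` cannot exist. -/
lemma exists_not_weak_super {G : ℕ → E2 → E2} (hG : ∀ k, Continuous (G k))
    (hmono : ∀ k p q, p ≠ q → 0 < ⟪G k p - G k q, p - q⟫) {Ω : Set E2} {v : ℕ → E2 → ℝ}
    (hv : ∀ k, LipOn (v k) Ω) (hw : ∀ k, WeakSol (G k) Ω (v k)) {w φ : E2 → ℝ}
    (hlim : TendstoUniformlyOn v w atTop Ω) (hφ : ContDiff ℝ 2 φ) {x₀ : E2} {R ε : ℝ}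
    (hR : 0 < R) (hε : 0 < ε) (hΩ : closedBall x₀ R ⊆ Ω)
    (hmax : ∀ x ∈ closedBall x₀ R, w x - φ x ≤ w x₀ - φ x₀) :
    ∀ᶠ k in atTop, ∃ η, IsTestFn (ball x₀ R) η ∧
      ∫ x, ⟪G k (gradient φ x + (2 * ε) • (x - x₀)), gradient η x⟫ < 0 := by
  filter_upwards [Metric.tendstoUniformlyOn_iff.1 hlim (ε * R ^ 2 / 4) (by positivity)] with k hk
  by_contra! hcon
  set c := w x₀ - φ x₀ - ε * R ^ 2 / 2 with hc
  have hcl : closure (ball x₀ R) = closedBall x₀ R := closure_ball _ hR.ne'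
  have hle := le_of_weak_le (hG k) (hmono k) (isOpen_ball (x := x₀) (ε := R)) isBounded_ball
    (w₁ := v k) (w₂ := fun y => φ y + ε * ‖y - x₀‖ ^ 2 + c) ((hv k).mono (hcl ▸ hΩ)) ?_ ?_ ?_
    x₀ (mem_ball_self hR)
  · have h1 := hk x₀ (hΩ (mem_closedBall_self hR.le))
    rw [Real.dist_eq, abs_lt] at h1
    simp only [sub_self, norm_zero] at hle
    have : 0 < ε * R ^ 2 := by positivity
    linarith [h1.1, h1.2]
  · have hcd : ContDiff ℝ 1 fun y => φ y + ε * ‖y - x₀‖ ^ 2 + c :=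
      ((hφ.of_le (by norm_num)).add (contDiff_const.mul
        ((contDiff_id.sub contDiff_const).norm_sq ℝ))).add contDiff_const
    rw [hcl]
    exact hcd.contDiffOn.exists_lipschitzOnWith one_ne_zero (convex_closedBall _ _)
      (isCompact_closedBall _ _)
  · intro x hx
    have hx' := frontier_ball_subset_sphere hx
    have hxc := sphere_subset_closedBall hx'
    have h1 := hk x (hΩ hxc)
    rw [Real.dist_eq, abs_lt] at h1
    rw [mem_sphere, dist_eq_norm] at hx'
    have := hmax x hxc
    simp only [hx']
    have : 0 < ε * R ^ 2 := by positivity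
    linarith [h1.1, h1.2]
  · intro η hη
    rw [hw k η (hη.mono (ball_subset_closedBall.trans hΩ))]
    simp only [gradient_add_sq_add_const (hφ.differentiable two_ne_zero)]
    exact hcon η hη

lemma exists_ratioOp_pos {p : E2 → E2} (hp : ContDiff ℝ 1 p) {x₀ : E2} {b : ℝ}
    (h : 0 < ratioOp b (p x₀) (fderiv ℝ p x₀)) :
    ∃ ε > (0:ℝ), ∀ᶠ z : ℝ × E2 in 𝓝 (b, x₀), 0 ≤ ratioOp z.1 (p z.2 + (2 * ε) • (z.2 - x₀))
      (fderiv ℝ p z.2 + (2 * ε) • ContinuousLinearMap.id ℝ E2) := by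
  have hfd := hp.continuous_fderiv one_ne_zero
  have hpc := hp.continuous
  have h1 : Continuous fun ε : ℝ => ratioOp b (p x₀)
      (fderiv ℝ p x₀ + (2 * ε) • ContinuousLinearMap.id ℝ E2) :=
    continuous_ratioOp.comp (g := fun z : ℝ × E2 × (E2 →L[ℝ] E2) => ratioOp z.1 z.2.1 z.2.2)
      (f := fun ε : ℝ => (b, p x₀, fderiv ℝ p x₀ + (2 * ε) • ContinuousLinearMap.id ℝ E2))
      (by fun_prop)
  have h2 : ∀ᶠ ε in 𝓝 (0:ℝ), 0 < ratioOp b (p x₀)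
      (fderiv ℝ p x₀ + (2 * ε) • ContinuousLinearMap.id ℝ E2) :=
    h1.continuousAt.eventually_const_lt (by
      have hz : (0:ℝ) • ContinuousLinearMap.id ℝ E2 = 0 := by ext; simp
      beta_reduce
      rwa [mul_zero, hz, add_zero])
  obtain ⟨ε, hε, hε0⟩ := ((h2.filter_mono nhdsWithin_le_nhds).and
    (self_mem_nhdsWithin : Ioi (0:ℝ) ∈ 𝓝[>] 0)).exists
  refine ⟨ε, hε0, ?_⟩
  have h3 : Continuous fun z : ℝ × E2 => ratioOp z.1 (p z.2 + (2 * ε) • (z.2 - x₀))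
      (fderiv ℝ p z.2 + (2 * ε) • ContinuousLinearMap.id ℝ E2) :=
    continuous_ratioOp.comp (g := fun z : ℝ × E2 × (E2 →L[ℝ] E2) => ratioOp z.1 z.2.1 z.2.2)
      (f := fun z : ℝ × E2 => (z.1, p z.2 + (2 * ε) • (z.2 - x₀),
        fderiv ℝ p z.2 + (2 * ε) • ContinuousLinearMap.id ℝ E2)) (by fun_prop)
  have h4 := (h3.continuousAt (x := (b, x₀))).eventually_const_lt (u := 0)
    (by simpa using hε)
  filter_upwards [h4] with z hz using hz.le

namespace IsLagrangian

variable {fa g : ℕ → ℝ → ℝ} {β : ℝ → ℝ}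

lemma continuousOn_ratio_inverse {f g : ℝ → ℝ} (hf : IsLagrangian f)
    (hC : ContDiffOn ℝ 1 (dtop f) (Ioi 0))
    (hg : ∀ r, 0 ≤ r → 0 ≤ g r ∧ dtop f (g r) = r) (hg' : ∀ ρ, 0 ≤ ρ → g (dtop f ρ) = ρ) :
    ContinuousOn (fun r => g r * deriv (dtop f) (g r) / dtop f (g r)) (Ioi 0) := by
  have hgc := (hf.continuousOn_inverse hg hg').mono Ioi_subset_Ici_self
  have hpos : MapsTo g (Ioi 0) (Ioi 0) := by
    intro r hr
    obtain ⟨h1, h2⟩ := hg r (le_of_lt hr)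
    refine lt_of_le_of_ne h1 fun h0 => ?_
    rw [← h0, hf.dtop_zero] at h2
    exact (ne_of_lt hr) h2
  refine (hgc.mul ((hC.continuousOn_deriv_of_isOpen isOpen_Ioi le_rfl).comp hgc hpos)).div
    (hC.continuousOn.comp hgc hpos) fun r hr => ?_
  rw [(hg r (le_of_lt hr)).2]
  exact ne_of_gt hr

/-- Locally uniform limits of solutions of `div (g(‖∇v‖) ∇v / ‖∇v‖) = 0` are viscosity
subsolutions of the limit equation. -/
lemma ratioOp_nonpos_of_isLocalMaxOn (hf : ∀ k, IsLagrangian (fa k))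
    (hC : ∀ k, ContDiffOn ℝ 1 (dtop (fa k)) (Ioi 0))
    (hg : ∀ k r, 0 ≤ r → 0 ≤ g k r ∧ dtop (fa k) (g k r) = r)
    (hg' : ∀ k ρ, 0 ≤ ρ → g k (dtop (fa k) ρ) = ρ)
    (hβ : ∀ K ⊆ Ioi (0:ℝ), IsCompact K → TendstoUniformlyOn
      (fun k r => g k r * deriv (dtop (fa k)) (g k r) / dtop (fa k) (g k r)) β atTop K)
    {Ω : Set E2} (hΩ : IsOpen Ω) {v : ℕ → E2 → ℝ} (hv : ∀ k, LipOn (v k) Ω)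
    (hw : ∀ k, WeakSol (radial (g k)) Ω (v k)) {w φ : E2 → ℝ}
    (hlim : TendstoUniformlyOn v w atTop Ω) (hφ : ContDiff ℝ 2 φ) {x₀ : E2} (hx₀ : x₀ ∈ Ω)
    (hmax : IsLocalMaxOn (fun y => w y - φ y) Ω x₀) :
    ratioOp (β ‖gradient φ x₀‖) (gradient φ x₀) (fderiv ℝ (gradient φ) x₀) ≤ 0 := by
  by_contra! hF
  set p := gradient φ with hpdef
  set s₀ := ‖p x₀‖ with hs₀
  have hs₀pos : 0 < s₀ := by
    refine norm_pos_iff.2 fun h0 => ?_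
    simp [ratioOp, h0] at hF
  have hp : ContDiff ℝ 1 p := hφ.gradient_of_two
  obtain ⟨ε, hε, hεF⟩ := exists_ratioOp_pos hp hF
  rw [nhds_prod_eq, eventually_prod_iff] at hεF
  obtain ⟨A, hA, B, hB, hAB⟩ := hεF
  obtain ⟨δ', hδ', hδA⟩ := Metric.eventually_nhds_iff.1 hA
  obtain ⟨δ, hδ, hδδ⟩ : ∃ δ > 0, 2 * δ < δ' := ⟨δ' / 3, by positivity, by linarith⟩
  have hK : Icc (s₀ / 2) (2 * s₀) ⊆ Ioi (0:ℝ) := fun r hr => lt_of_lt_of_le (by positivity) hr.1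
  have hKβ := hβ _ hK isCompact_Icc
  have hβc : ContinuousAt β s₀ := by
    refine (hKβ.continuousOn (Eventually.of_forall fun k => ?_).frequently).continuousAt
      (Icc_mem_nhds (by linarith) (by linarith))
    exact ((hf k).continuousOn_ratio_inverse (hC k) (hg k) (hg' k)).mono hK
  obtain ⟨t, ht, htβ⟩ := Metric.continuousAt_iff.1 hβc (δ / 2) (by positivity)
  set τ := min (t / 4) (s₀ / 4) with hτdef
  have hτ : 0 < τ := by positivity
  have hτt : τ ≤ t / 4 := min_le_left _ _
  have hτs : τ ≤ s₀ / 4 := min_le_right _ _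
  set q : E2 → E2 := fun x => p x + (2 * ε) • (x - x₀) with hq
  have hqC : ContDiff ℝ 1 q := by fun_prop
  have hqd : ∀ x, fderiv ℝ q x = fderiv ℝ p x + (2 * ε) • ContinuousLinearMap.id ℝ E2 := by
    intro x
    exact ((hp.differentiable one_ne_zero x).hasFDerivAt.add
      (((hasFDerivAt_id x).sub_const x₀).const_smul (2 * ε))).fderiv
  have hev : ∀ᶠ x in 𝓝 x₀, B x ∧ |‖q x‖ - s₀| < τ ∧ x ∈ Ω ∧ w x - φ x ≤ w x₀ - φ x₀ := by
    have hqt : ContinuousAt (fun x => |‖q x‖ - s₀|) x₀ := by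
      have := hqC.continuous
      fun_prop
    refine hB.and ((hqt.eventually_lt_const ?_).and ((hΩ.eventually_mem hx₀).and ?_))
    · simpa [hq, hs₀] using hτ
    · rw [IsLocalMaxOn, hΩ.nhdsWithin_eq hx₀] at hmax
      exact hmax
  obtain ⟨R', hR', hball⟩ := Metric.eventually_nhds_iff.1 hev
  obtain ⟨R, hR, hRR⟩ : ∃ R > 0, R < R' := ⟨R' / 2, by positivity, by linarith⟩
  have hcb : ∀ x ∈ closedBall x₀ R,
      B x ∧ |‖q x‖ - s₀| < τ ∧ x ∈ Ω ∧ w x - φ x ≤ w x₀ - φ x₀ := fun x hx =>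
    hball (lt_of_le_of_lt (mem_closedBall.1 hx) hRR)
  have hbad := exists_not_weak_super
    (fun k => continuous_radial ((hf k).continuousOn_inverse (hg k) (hg' k))
      (by simpa [(hf k).dtop_zero] using hg' k 0 le_rfl) fun r hr => (hg k r hr).1)
    (fun k a b hab => _root_.inner_radial_sub_pos ((hf k).strictMonoOn_inverse (hg k))
      (by simpa [(hf k).dtop_zero] using hg' k 0 le_rfl) hab)
    hv hw hlim hφ hR hε (fun x hx => (hcb x hx).2.2.1) fun x hx => (hcb x hx).2.2.2
  obtain ⟨k, ⟨η, hη, hneg⟩, hk⟩ :=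
    (hbad.and (Metric.tendstoUniformlyOn_iff.1 hKβ (δ / 2) (by positivity))).exists
  refine hneg.not_ge ((hf k).integral_inner_radial_inverse_nonneg (hC k) (hg k) (hg' k) hqC
    (s₀ := s₀) (τ := τ) (b := β s₀) hτ hδ (by linarith) (fun x hx => (hcb x hx).2.1.le) ?_ ?_ hη)
  · intro ρ hρ hρs
    rw [abs_le] at hρs
    have h1 := hk (dtop (fa k) ρ) ⟨by linarith [hρs.1], by linarith [hρs.2]⟩
    have h2 := htβ (x := dtop (fa k) ρ) (by
      rw [Real.dist_eq, abs_lt]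
      constructor <;> linarith [hρs.1, hρs.2])
    rw [hg' k ρ hρ.le, Real.dist_eq, abs_lt] at h1
    rw [Real.dist_eq, abs_lt] at h2
    rw [abs_le]
    constructor <;> linarith [h1.1, h1.2, h2.1, h2.2]
  · intro x hx c hc
    rw [hqd]
    exact hAB (hδA (lt_of_le_of_lt (by rwa [Real.dist_eq]) hδδ)) (hcb x hx).1

end IsLagrangian

/-- Locally uniform limits of solutions of `div (g(‖∇v‖) ∇v / ‖∇v‖) = 0` are viscosity
solutions of the limit equation. -/
lemma viscositySol_of_tendstoUniformlyOn {fa g : ℕ → ℝ → ℝ} {β : ℝ → ℝ}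
    (hf : ∀ k, IsLagrangian (fa k)) (hC : ∀ k, ContDiffOn ℝ 1 (dtop (fa k)) (Ioi 0))
    (hg : ∀ k r, 0 ≤ r → 0 ≤ g k r ∧ dtop (fa k) (g k r) = r)
    (hg' : ∀ k ρ, 0 ≤ ρ → g k (dtop (fa k) ρ) = ρ)
    (hβ : ∀ K ⊆ Ioi (0:ℝ), IsCompact K → TendstoUniformlyOn
      (fun k r => g k r * deriv (dtop (fa k)) (g k r) / dtop (fa k) (g k r)) β atTop K)
    {Ω : Set E2} (hΩ : IsOpen Ω) {v : ℕ → E2 → ℝ} (hv : ∀ k, LipOn (v k) Ω)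
    (hw : ∀ k, WeakSol (radial (g k)) Ω (v k)) {w : E2 → ℝ}
    (hlim : TendstoUniformlyOn v w atTop Ω) :
    ViscositySol Ω (fun p H => ratioOp (β ‖p‖) p H) w := by
  refine ⟨hlim.continuousOn (Eventually.of_forall fun k => (hv k).choose_spec.continuousOn).frequently,
    fun x hx φ hφ hmax => IsLagrangian.ratioOp_nonpos_of_isLocalMaxOn hf hC hg hg' hβ hΩ hv hw hlim
      hφ hx hmax, fun x hx φ hφ hmin => ?_⟩
  have hgrad : gradient (fun y => -φ y) = fun y => -gradient φ y :=
    funext fun y => gradient_neg_fun φ y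
  have hmax : IsLocalMaxOn (fun y => -w y - -φ y) Ω x :=
    hmin.neg.congr (Eventually.of_forall fun y => by
      dsimp only
      ring) hx
  have h := IsLagrangian.ratioOp_nonpos_of_isLocalMaxOn hf hC hg hg' hβ hΩ
    (v := fun k y => -v k y) (w := fun y => -w y) (φ := fun y => -φ y)
    (fun k => (hv k).imp fun L hL => hL.neg) ?_ ?_ hφ.neg hx hmax
  · rw [hgrad, fderiv_fun_neg] at h
    simp only [ratioOp, norm_neg, neg_apply, map_neg, inner_neg_neg,
      ContinuousLinearMap.toLinearMap_neg] at h
    simp only [ratioOp]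
    rw [inner_neg_left] at h
    linarith
  · intro k η hη
    simp only [gradient_neg_fun, radial_neg, inner_neg_left, integral_neg, hw k η hη, neg_zero]
  · exact hlim.neg

/-- In the approximation scheme, if `αₐ ∘ g'ₐ` converges uniformly on
compact subsets of `[0,∞)` to `β`, then the stream functions `vₐ` subconverge uniformly on
`Ω` to a viscosity solution `v` of `−[1 − β(‖∇v‖)]·Δ∞v − ‖∇v‖²·β(‖∇v‖)·Δv = 0`. -/
theorem stream_functions_subconverge_to_viscositySolution
    (f : ℝ → ℝ) (hf : StdF f)
    (Ω : Set E2) (hΩo : IsOpen Ω) (hΩb : Bornology.IsBounded Ω)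
    (hsc : SimplyConnectedSpace ↥Ω)
    (ψ : E2 → ℝ) (hψ : ContinuousOn ψ (frontier Ω))
    (Q : ℝ) (hQ : 0 < Q) (hbsc : BSC Ω ψ Q)
    (hlim0 : ∃ ℓ : ℝ, Tendsto (fun ρ => ρ * deriv (dtop f) ρ / dtop f ρ)
      (nhdsWithin 0 (Set.Ioi 0)) (nhds ℓ))
    (αinf : ℝ) (hαinf : 0 < αinf)
    (hliminf : Tendsto (fun ρ => ρ * deriv (dtop f) ρ / dtop f ρ) atTop (nhds αinf))
    (fa : ℕ → ℝ → ℝ)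
    (hconv : ∀ a, StrictConvexOn ℝ (Set.Ici 0) (fa a))
    (hC1 : ∀ a, ContDiffOn ℝ 1 (fa a) (Set.Ici 0))
    (hC2 : ∀ a, ContDiffOn ℝ 2 (fa a) (Set.Ioi 0))
    (h0 : ∀ a, dtop (fa a) 0 = 0)
    (hmono : ∀ a, StrictMonoOn (dtop (fa a)) (Set.Ici 0))
    (hbij : ∀ a, Set.BijOn (dtop (fa a)) (Set.Ici 0) (Set.Ici 0))
    (gpa : ℕ → ℝ → ℝ)
    (hinv : ∀ a, Set.InvOn (gpa a) (dtop (fa a)) (Set.Ici 0) (Set.Ici 0))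
    (hunif : TendstoUniformlyOn (fun a ρ => fa a ρ) f atTop (Set.Ici 0))
    (αa : ℕ → ℝ → ℝ)
    (hαa : ∀ a, ∀ ρ : ℝ, ρ ≠ 0 →
      αa a ρ = ρ * deriv (dtop (fa a)) ρ / dtop (fa a) ρ)
    (hαa0 : ∀ a, 0 < αa a 0 ∧
      Tendsto (fun ρ => ρ * deriv (dtop (fa a)) ρ / dtop (fa a) ρ)
        (nhdsWithin 0 (Set.Ioi 0)) (nhds (αa a 0)))
    (ua : ℕ → E2 → ℝ) (hua : ∀ a, SolvesP (fa a) Ω ψ (ua a))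
    (va : ℕ → E2 → ℝ) (hva : ∀ a, IsStreamFn (dtop (fa a)) Ω (ua a) (va a))
    (β : ℝ → ℝ)
    (hβ : ∀ K : Set ℝ, IsCompact K → K ⊆ Set.Ici 0 →
      TendstoUniformlyOn (fun a r => αa a (gpa a r)) β atTop K) :
    ∃ σ : ℕ → ℕ, StrictMono σ ∧ ∃ v : E2 → ℝ,
      TendstoUniformlyOn (fun k => va (σ k)) v atTop Ω ∧
      ViscositySol Ω
        (fun p H => -(1 - β ‖p‖) * ⟪H p, p⟫
          - ‖p‖ ^ 2 * β ‖p‖ * LinearMap.trace ℝ E2 H.toLinearMap) v := by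
  have hL : ∀ a, IsLagrangian (fa a) := fun a =>
    ⟨(hconv a).convexOn, hC1 a, h0 a, hmono a⟩
  have hC : ∀ a, ContDiffOn ℝ 1 (dtop (fa a)) (Ioi 0) := fun a =>
    ((hC2 a).deriv_of_isOpen isOpen_Ioi (by norm_num)).congr fun ρ hρ =>
      derivWithin_of_mem_nhds (Ici_mem_nhds hρ)
  have hg' : ∀ a ρ, 0 ≤ ρ → gpa a (dtop (fa a) ρ) = ρ := fun a ρ hρ => (hinv a).1 hρ
  have hg : ∀ a r, 0 ≤ r → 0 ≤ gpa a r ∧ dtop (fa a) (gpa a r) = r := by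
    intro a r hr
    obtain ⟨ρ, hρ, rfl⟩ := (hbij a).surjOn hr
    rw [hg' a ρ hρ]
    exact ⟨hρ, rfl⟩
  have hβ' : ∀ K ⊆ Ioi (0:ℝ), IsCompact K → TendstoUniformlyOn
      (fun a r => gpa a r * deriv (dtop (fa a)) (gpa a r) / dtop (fa a) (gpa a r)) β atTop K := by
    intro K hK hKc
    refine (hβ K hKc (hK.trans Ioi_subset_Ici_self)).congr (Eventually.of_forall fun a r hr => ?_)
    refine hαa a _ fun hz => ?_
    have := (hg a r (le_of_lt (hK hr))).2
    rw [hz, h0] at this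
    exact (ne_of_lt (hK hr)) this
  have hw : ∀ a, WeakSol (radial (gpa a)) Ω (va a) := fun a =>
    IsStreamFn.weakSol (fun r hr => (hL a).dtop_nonneg hr) (hg' a) (h0 a) hΩo hΩb
      ((hua a).1.mono subset_closure) (hva a)
  have hpre : IsPreconnected Ω := isPreconnected_iff_preconnectedSpace.2 inferInstance
  obtain ⟨N, hN⟩ := eventually_atTop.1 (Metric.tendstoUniformlyOn_iff.1 hunif 1 one_pos)
  set M : NNReal := (f (Q + 1) - f Q + 2).toNNReal with hM
  have hLip : ∀ n, LipschitzOnWith M (va (N + n)) Ω := by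
    intro n
    refine (hva (N + n)).lipschitzOnWith (hL _) hΩo hΩb hpre (Q := ⟨Q, hQ.le⟩) hbsc (hua _) ?_
    refine le_trans ?_ (Real.le_coe_toNNReal _)
    have h1 := (hL (N + n)).add_dtop_mul_le hQ.le (by linarith : (0:ℝ) ≤ Q + 1)
    have h2 := hN (N + n) (Nat.le_add_right _ _) Q hQ.le
    have h3 := hN (N + n) (Nat.le_add_right _ _) (Q + 1) (by linarith : (0:ℝ) ≤ Q + 1)
    rw [Real.dist_eq, abs_lt] at h2 h3
    change dtop (fa (N + n)) Q ≤ _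
    linarith [h2.1, h2.2, h3.1, h3.2]
  obtain ⟨σ, hσ, v, hv⟩ := exists_subseq_tendstoUniformlyOn_of_lipschitzOnWith hΩb hLip
    fun n => abs_le_of_setIntegral_eq_zero hΩo hΩb (hLip n) (hva (N + n)).2.1
  refine ⟨fun k => N + σ k, fun i j hij => Nat.add_lt_add_left (hσ hij) N, v, hv, ?_⟩
  have hσ' : Tendsto (fun k => N + σ k) atTop atTop :=
    tendsto_atTop_mono (fun k => Nat.le_add_left _ _) hσ.tendsto_atTop
  exact viscositySol_of_tendstoUniformlyOn (fun k => hL (N + σ k)) (fun k => hC (N + σ k))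
    (fun k => hg (N + σ k)) (fun k => hg' (N + σ k))
    (fun K hK hKc => fun u hu => hσ'.eventually (hβ' K hK hKc u hu)) hΩo
    (fun k => (hva (N + σ k)).1) (fun k => hw (N + σ k)) hv
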